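/- Let h be an odd prime dividing the class number of K = ℚ(ζ_p), and suppose the h-Sylow subgroup of the ideal class group of K is cyclic. Let M be the smallest subfield of K (i.e. the intermediate field of K/ℚ of minimal degree) whose class number is divisible by h, and let n = [M:ℚ]. If h is coprime to n, then n divides h − 1. -/

import Mathlib

open NumberField

namespace S19

open MeasureTheory Module

section lattice

variable {E : Type*} [NormedAddCommGroup E] [NormedSpace ℝ E] [FiniteDimensional ℝ E]

theorem finite_lattice_ball (L : Submodule ℤ E) [DiscreteTopology L] (A : ℝ) :
    {x : L | ‖(x : E)‖ ≤ A}.Finite := by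
  have h1 : (Metric.closedBall (0 : E) A ∩ (L : Set E)).Finite := by
    have : ProperSpace E := FiniteDimensional.proper ℝ E
    have : DiscreteTopology L.toAddSubgroup := ‹DiscreteTopology L›
    refine Metric.finite_isBounded_inter_isClosed DiscreteTopology.isDiscrete
      Metric.isBounded_closedBall ?_
    change IsClosed (L.toAddSubgroup : Set E)
    exact AddSubgroup.isClosed_of_discrete
  refine Set.Finite.of_finite_image (f := Subtype.val) (h1.subset ?_)
    Subtype.val_injective.injOn
  rintro _ ⟨x, hx, rfl⟩
  exact ⟨by simpa using hx, x.2⟩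

theorem finite_support_lattice (L : Submodule ℤ E) [DiscreteTopology L] {F : E → ℝ} {R : ℝ}
    (hR : ∀ x, R < ‖x‖ → F x = 0) (r : E) {T : ℝ} (hT : 0 < T) :
    (Function.support fun x : L => F (T⁻¹ • ((x : E) + r))).Finite := by
  refine (finite_lattice_ball L (R * T + ‖r‖)).subset ?_
  intro x hx
  by_contra hcon
  apply hx
  apply hR
  simp only [Set.mem_ofPred_eq, not_le] at hcon
  rw [norm_smul, norm_inv, Real.norm_of_nonneg hT.le, inv_mul_eq_div, lt_div_iff₀ hT]
  have := norm_sub_le ((x : E) + r) r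
  simp only [add_sub_cancel_right] at this
  linarith

theorem lattice_sum [MeasurableSpace E] [BorelSpace E] (μ : Measure E) [μ.IsAddHaarMeasure]
    (L : Submodule ℤ E) [DiscreteTopology L] [IsZLattice ℝ L]
    (F : E → ℝ) (C : NNReal) (hF : LipschitzWith C F) (R : ℝ) (hR0 : 0 ≤ R)
    (hR : ∀ x, R < ‖x‖ → F x = 0) (r : E) (t0 : ℝ) (ht0 : 0 < t0) :
    ∃ B : ℝ, ∀ T : ℝ, t0 ≤ T →
      |∑' x : L, F (T⁻¹ • ((x : E) + r)) -
        T ^ finrank ℝ E * ((∫ x, F x ∂μ) / ZLattice.covolume L μ)| ≤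
        B * (T ^ finrank ℝ E * T⁻¹) := by
  classical
  have : ProperSpace E := FiniteDimensional.proper ℝ E
  have : Countable L := ZLattice.FG ℝ L |> fun h => by
    have := ZLattice.module_finite ℝ L
    have := ZLattice.module_free ℝ L
    exact (Module.Free.chooseBasis ℤ L).equivFun.toEquiv.countable_iff.mpr inferInstance
  have := ZLattice.module_finite ℝ L
  have := ZLattice.module_free ℝ L
  set b := Module.Free.chooseBasis ℤ L with hb
  set D := ZSpan.fundamentalDomain (b.ofZLatticeBasis ℝ) with hD
  have hfd : IsAddFundamentalDomain L D μ := ZLattice.isAddFundamentalDomain b μ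
  have hDb : Bornology.IsBounded D := ZSpan.fundamentalDomain_isBounded _
  have hDm : MeasurableSet D := ZSpan.fundamentalDomain_measurableSet _
  obtain ⟨d, hd0, hd⟩ := hDb.exists_pos_norm_le
  have hcov : ZLattice.covolume L μ = μ.real D :=
    ZLattice.covolume_eq_measure_fundamentalDomain L μ hfd
  have hcovpos : 0 < ZLattice.covolume L μ := ZLattice.covolume_pos L μ
  have hDfin : μ D ≠ ⊤ := hDb.measure_lt_top.ne
  have hvadd : VAddInvariantMeasure L E μ := ⟨fun c s _ => measure_preimage_add μ (c : E) s⟩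
  set n := finrank ℝ E with hn
  set A1 := R + (‖r‖ + d) / t0 with hA1
  refine ⟨(C * d) * (A1 ^ n * μ.real (Metric.closedBall 0 1)) / ZLattice.covolume L μ, ?_⟩
  intro T hT
  have hTpos : 0 < T := ht0.trans_le hT
  set G : E → ℝ := fun y => F (T⁻¹ • (y + r)) with hG
  have hFcont := hF.continuous
  have hGcont : Continuous G := by fun_prop
  set A := R * T + ‖r‖ + d with hA
  have hA0 : 0 ≤ A := by positivity
  have hGsupp : ∀ y, R * T < ‖y + r‖ → G y = 0 := by
    intro y hy
    apply hR
    rwa [norm_smul, norm_inv, Real.norm_of_nonneg hTpos.le, inv_mul_eq_div, lt_div_iff₀ hTpos]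
  have hGcs : HasCompactSupport G := by
    refine HasCompactSupport.intro (isCompact_closedBall (0 : E) A) ?_
    intro y hy
    apply hGsupp
    simp only [Metric.mem_closedBall, dist_zero_right, not_le] at hy
    have := norm_sub_le (y + r) r
    simp only [add_sub_cancel_right] at this
    linarith
  have hGint : Integrable G μ := hGcont.integrable_of_hasCompactSupport hGcs
  have hIntG : ∫ y, G y ∂μ = T ^ n * ∫ x, F x ∂μ := by
    have h1 : ∫ y, G y ∂μ = ∫ y, F (T⁻¹ • y) ∂μ :=
      integral_add_right_eq_self (μ := μ) (fun y => F (T⁻¹ • y)) r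
    rw [h1, Measure.integral_comp_inv_smul_of_nonneg _ _ hTpos.le, smul_eq_mul]
  have hsum1 : ∫ y, G y ∂μ = ∑' x : L, ∫ y in D, G (x + y) ∂μ :=
    hfd.integral_eq_tsum'' G hGint
  set I : E → ℝ := (Metric.closedBall (0 : E) A).indicator (fun _ => C * d / T) with hI
  have hIint : Integrable I μ := by
    rw [hI, integrable_indicator_iff Metric.isClosed_closedBall.measurableSet]
    exact integrableOn_const (hs := (measure_closedBall_lt_top).ne)
  have hsum2 : ∫ y, I y ∂μ = ∑' x : L, ∫ y in D, I (x + y) ∂μ :=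
    hfd.integral_eq_tsum'' I hIint
  have hIval : ∫ y, I y ∂μ = C * d / T * μ.real (Metric.closedBall 0 A) := by
    rw [hI, integral_indicator Metric.isClosed_closedBall.measurableSet, setIntegral_const,
      smul_eq_mul, mul_comm]
  -- finite supports
  have hfar : ∀ (x : L), ¬ ‖(x : E)‖ ≤ A + d → ∀ y ∈ D, A < ‖(x : E) + y‖ := by
    intro x hx y hy
    have := norm_sub_le ((x : E) + y) y
    simp only [add_sub_cancel_right] at this
    have := hd y hy
    linarith
  have hGfar : ∀ y, A < ‖y‖ → G y = 0 := by
    intro y hy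
    apply hGsupp
    have := norm_sub_le (y + r) r
    simp only [add_sub_cancel_right] at this
    linarith
  have hfin := finite_lattice_ball L (A + d)
  have hs1 : Summable fun x : L => ∫ y in D, G (x + y) ∂μ := by
    refine summable_of_hasFiniteSupport (hfin.subset ?_)
    intro x hx
    by_contra hcon
    apply hx
    exact setIntegral_eq_zero_of_forall_eq_zero fun y hy => hGfar _ (hfar x hcon y hy)
  have hs2 : Summable fun x : L => ∫ y in D, I (x + y) ∂μ := by
    refine summable_of_hasFiniteSupport (hfin.subset ?_)
    intro x hx
    by_contra hcon
    apply hx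
    refine setIntegral_eq_zero_of_forall_eq_zero fun y hy => ?_
    rw [hI, Set.indicator_of_notMem]
    simpa using hfar x hcon y hy
  have hs3 : Summable fun x : L => G x :=
    summable_of_hasFiniteSupport (finite_support_lattice L hR r hTpos)
  have hs3' : ∑' x : L, G x * μ.real D = (∑' x : L, G x) * μ.real D := tsum_mul_right
  have hterm : ∀ x : L, |(∫ y in D, G (x + y) ∂μ) - G x * μ.real D| ≤ ∫ y in D, I (x + y) ∂μ := by
    intro x
    have e1 : G x * μ.real D = ∫ y in D, G x ∂μ := by
      rw [setIntegral_const, smul_eq_mul, mul_comm]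
    have i1 : IntegrableOn (fun y => G (x + y)) D μ :=
      (hGint.comp_add_left (x : E)).integrableOn
    have i2 : IntegrableOn (fun _ : E => G x) D μ := integrableOn_const (hs := hDfin)
    have i3 : IntegrableOn (fun y => I (x + y)) D μ :=
      (hIint.comp_add_left (x : E)).integrableOn
    rw [e1, ← integral_sub i1 i2]
    refine (abs_integral_le_integral_abs).trans ?_
    refine setIntegral_mono_on (i1.sub i2).abs i3 hDm ?_
    intro y hy
    by_cases hball : ‖(x : E) + y‖ ≤ A
    · rw [hI, Set.indicator_of_mem (by simpa using hball)]
      have := hF.dist_le_mul (T⁻¹ • ((x : E) + y + r)) (T⁻¹ • ((x : E) + r))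
      rw [Real.dist_eq] at this
      refine this.trans ?_
      rw [dist_eq_norm, ← smul_sub, norm_smul, norm_inv, Real.norm_of_nonneg hTpos.le]
      have e2 : (x : E) + y + r - (x + r) = y := by abel
      rw [e2]
      have := hd y hy
      rw [mul_div_assoc, inv_mul_eq_div]
      gcongr
    · have g1 : G (x + y) = 0 := hGfar _ (not_le.mp hball)
      have g2 : G x = 0 := by
        apply hGsupp
        have h3 := norm_sub_le ((x : E) + r) (r - y)
        have h4 : (x : E) + r - (r - y) = x + y := by abel
        rw [h4] at h3
        have h5 := norm_sub_le r y
        have := hd y hy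
        push Not at hball
        linarith
      rw [hI, Set.indicator_of_notMem (by simpa using hball), g1, g2]
      simp
  have hmain : |T ^ n * (∫ x, F x ∂μ) - (∑' x : L, G x) * μ.real D| ≤
      C * d / T * μ.real (Metric.closedBall 0 A) := by
    rw [← hIntG, hsum1, ← hs3', ← Summable.tsum_sub hs1 (hs3.mul_right _), ← hIval, hsum2]
    rw [← Real.norm_eq_abs]
    refine tsum_of_norm_bounded hs2.hasSum ?_
    intro x
    rw [Real.norm_eq_abs]
    exact hterm x
  have hvol : μ.real (Metric.closedBall (0 : E) A) ≤
      (A1 * T) ^ n * μ.real (Metric.closedBall 0 1) := by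
    have e : μ.real (Metric.closedBall (0 : E) A) = A ^ n * μ.real (Metric.closedBall 0 1) := by
      rw [Measure.real, Measure.addHaar_closedBall' μ 0 hA0, ENNReal.toReal_mul,
        ENNReal.toReal_ofReal (by positivity), Measure.real]
    rw [e]
    have : A ≤ A1 * T := by
      have h6 : (‖r‖ + d) ≤ (‖r‖ + d) / t0 * T := by
        rw [div_mul_eq_mul_div, le_div_iff₀ ht0]
        gcongr
      rw [hA, hA1, add_mul]
      linarith
    gcongr
  rw [hcov] at hcovpos ⊢
  have e5 : (∑' x : L, G x) - T ^ n * ((∫ x, F x ∂μ) / μ.real D) =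
      - ((T ^ n * (∫ x, F x ∂μ) - (∑' x : L, G x) * μ.real D) / μ.real D) := by
    field_simp
    ring
  change |(∑' x : L, G x) - T ^ n * ((∫ x, F x ∂μ) / μ.real D)| ≤ _
  rw [e5, abs_neg, abs_div, abs_of_pos hcovpos, div_le_iff₀ hcovpos]
  refine hmain.trans ?_
  calc C * d / T * μ.real (Metric.closedBall 0 A)
      ≤ C * d / T * ((A1 * T) ^ n * μ.real (Metric.closedBall 0 1)) := by gcongr
    _ = _ := by
      rw [mul_pow]
      field_simp

end lattice

end S19

namespace S19

open MeasureTheory Module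

section periodic

variable {E : Type*} [NormedAddCommGroup E] [NormedSpace ℝ E] [FiniteDimensional ℝ E]

set_option maxHeartbeats 1000000 in
theorem periodic_zero [MeasurableSpace E] [BorelSpace E]
    (L : Submodule ℤ E) [DiscreteTopology L] [IsZLattice ℝ L]
    (F : E → ℝ) (C : NNReal) (hF : LipschitzWith C F) (R : ℝ) (hR0 : 0 ≤ R)
    (hR : ∀ x, R < ‖x‖ → F x = 0) (t0 : ℝ) (ht0 : 0 < t0)
    (p : ℕ) (hp : 0 < p) (g : L → ℂ) (hg : ∀ x y : L, g (x + (p : ℤ) • y) = g x)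
    (a : ℤ) (ha : IsCoprime a (p : ℤ)) (ε : ℂ) (hε : ε ≠ 1) (hga : ∀ x, g (a • x) = ε * g x) :
    ∃ B : ℝ, ∀ T : ℝ, t0 ≤ T →
      ‖∑' x : L, g x * (F (T⁻¹ • (x : E)) : ℂ)‖ ≤ B * (T ^ finrank ℝ E * T⁻¹) := by
  classical
  have := ZLattice.module_finite ℝ L
  let N : Submodule ℤ L := LinearMap.range (LinearMap.lsmul ℤ L (p : ℤ))
  have hmemN : ∀ x : L, x ∈ N ↔ ∃ y : L, (p : ℤ) • y = x := fun x => by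
    simp [N, LinearMap.mem_range]
  have htor : Module.IsTorsion ℤ (L ⧸ N) := by
    intro x
    obtain ⟨x, rfl⟩ := N.mkQ_surjective x
    refine ⟨⟨(p : ℤ), mem_nonZeroDivisors_of_ne_zero (by exact_mod_cast hp.ne')⟩, ?_⟩
    change (p : ℤ) • N.mkQ x = 0
    rw [← map_smul, Submodule.mkQ_apply, Submodule.Quotient.mk_eq_zero, hmemN]
    exact ⟨x, rfl⟩
  have hfin : Finite (L ⧸ N) := Module.finite_of_fg_torsion _ htor
  have := Fintype.ofFinite (L ⧸ N)
  have hgN : ∀ x y : L, N.mkQ x = N.mkQ y → g x = g y := by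
    intro x y hxy
    have : x - y ∈ N := (Submodule.Quotient.eq N).mp hxy
    obtain ⟨z, hz⟩ := (hmemN _).mp this
    have : x = y + (p : ℤ) • z := by rw [hz]; abel
    rw [this, hg]
  let rep : L ⧸ N → L := Function.surjInv N.mkQ_surjective
  have hrep : ∀ q, N.mkQ (rep q) = q := Function.surjInv_eq N.mkQ_surjective
  -- average vanishes
  have hzero : ∑ q, g (rep q) = 0 := by
    let φ : L ⧸ N →ₗ[ℤ] L ⧸ N := LinearMap.lsmul ℤ (L ⧸ N) a
    have hφ : Function.Surjective φ := by
      intro q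
      obtain ⟨u, v, huv⟩ := ha
      refine ⟨u • q, ?_⟩
      change a • (u • q) = q
      have hpq : (p : ℤ) • q = 0 := by
        rw [← hrep q, ← map_smul, Submodule.mkQ_apply, Submodule.Quotient.mk_eq_zero, hmemN]
        exact ⟨_, rfl⟩
      have : (u * a + v * p) • q = q := by rw [huv, one_smul]
      rw [add_smul, mul_smul, mul_smul, hpq, smul_zero, add_zero] at this
      rw [smul_comm]; exact this
    have hbij : Function.Bijective φ := ⟨Finite.injective_iff_surjective.mpr hφ, hφ⟩
    have h1 : ∑ q, g (rep (φ q)) = ∑ q, g (rep q) :=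
      Function.Bijective.sum_comp hbij fun q => g (rep q)
    have h2 : ∀ q, g (rep (φ q)) = ε * g (rep q) := by
      intro q
      rw [← hga]
      apply hgN
      rw [hrep, map_smul, hrep]
      rfl
    simp only [h2, ← Finset.mul_sum] at h1
    have : (ε - 1) * ∑ q, g (rep q) = 0 := by rw [sub_mul, h1]; ring
    exact (mul_eq_zero.mp this).resolve_left (sub_ne_zero.mpr hε)
  -- equivalence
  let f : (L ⧸ N) × L → L := fun z => rep z.1 + (p : ℤ) • z.2
  have hf : Function.Bijective f := by
    constructor
    · rintro ⟨q, y⟩ ⟨q', y'⟩ h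
      simp only [f] at h
      have hq : q = q' := by
        have := congrArg N.mkQ h
        rw [map_add, map_add, hrep, hrep] at this
        have e : ∀ y : L, N.mkQ ((p : ℤ) • y) = 0 := fun y => by
          rw [Submodule.mkQ_apply, Submodule.Quotient.mk_eq_zero, hmemN]; exact ⟨y, rfl⟩
        rwa [e, e, add_zero, add_zero] at this
      subst hq
      have h' : (p : ℤ) • y = (p : ℤ) • y' := add_left_cancel h
      have : (p : ℤ) • (y : E) = (p : ℤ) • (y' : E) := by
        simpa using congrArg (Subtype.val) h'
      have hp' : (p : ℤ) ≠ 0 := by exact_mod_cast hp.ne'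
      rw [← Int.cast_smul_eq_zsmul ℝ, ← Int.cast_smul_eq_zsmul ℝ] at this
      have := smul_right_injective E (r := ((p : ℤ) : ℝ)) (by exact_mod_cast hp.ne') this
      simp [Subtype.ext this]
    · intro x
      have : x - rep (N.mkQ x) ∈ N := by
        exact (Submodule.Quotient.eq N).mp (hrep _).symm
      obtain ⟨y, hy⟩ := (hmemN _).mp this
      exact ⟨(N.mkQ x, y), by simp only [f]; rw [hy]; abel⟩
  have hppos : (0 : ℝ) < p := by exact_mod_cast hp
  choose B hB using fun q : L ⧸ N => lattice_sum (Measure.addHaar) L F C hF R hR0 hR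
    ((p : ℝ)⁻¹ • (rep q : E)) (t0 / p) (by positivity)
  refine ⟨(∑ q, ‖g (rep q)‖ * B q) * ((p : ℝ)⁻¹ ^ finrank ℝ E * p), ?_⟩
  intro T hT
  have hTpos : 0 < T := ht0.trans_le hT
  have hsupp : (Function.support fun x : L => g x * (F (T⁻¹ • (x : E)) : ℂ)).Finite := by
    refine (finite_support_lattice L hR 0 hTpos).subset ?_
    intro x hx hx'
    apply hx
    simp only [add_zero] at hx'
    simp [hx']
  have hsm : Summable fun z => (fun x : L => g x * (F (T⁻¹ • (x : E)) : ℂ)) (f z) :=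
    (Equiv.ofBijective f hf).summable_iff.mpr (summable_of_hasFiniteSupport hsupp)
  have key : ∀ q (y : L), F (T⁻¹ • ((f (q, y) : L) : E)) =
      F ((T / p)⁻¹ • ((y : E) + (p : ℝ)⁻¹ • (rep q : E))) := by
    intro q y
    congr 1
    simp only [f, Submodule.coe_add, Submodule.coe_smul]
    rw [← Int.cast_smul_eq_zsmul ℝ, inv_div, smul_add, smul_add, smul_smul, smul_smul]
    have e1 : (p : ℝ) / T * (p : ℝ)⁻¹ = T⁻¹ := by field_simp
    have e2 : T⁻¹ * (((p : ℤ)) : ℝ) = (p : ℝ) / T := by push_cast; field_simp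
    rw [e1, e2, add_comm]
  have heq : ∑' x : L, g x * (F (T⁻¹ • (x : E)) : ℂ) =
      ∑ q, g (rep q) * ((∑' y : L, F ((T / p)⁻¹ • ((y : E) + (p : ℝ)⁻¹ • (rep q : E))) : ℝ) : ℂ) := by
    rw [← (Equiv.ofBijective f hf).tsum_eq]
    change ∑' z, (fun x : L => g x * (F (T⁻¹ • (x : E)) : ℂ)) (f z) = _
    rw [hsm.tsum_prod, tsum_fintype]
    refine Finset.sum_congr rfl fun q _ => ?_
    rw [Complex.ofReal_tsum, ← tsum_mul_left]
    refine tsum_congr fun y => ?_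
    simp only [key]
    congr 1
    exact hg _ _
  set Z : ℝ := (T / p) ^ finrank ℝ E * ((∫ x, F x ∂Measure.addHaar) / ZLattice.covolume L Measure.addHaar) with hZ
  have heq2 : ∑' x : L, g x * (F (T⁻¹ • (x : E)) : ℂ) =
      ∑ q, g (rep q) * (((∑' y : L, F ((T / p)⁻¹ • ((y : E) + (p : ℝ)⁻¹ • (rep q : E)))) - Z : ℝ) : ℂ) := by
    rw [heq]
    push_cast
    simp only [mul_sub, Finset.sum_sub_distrib, ← Finset.sum_mul, hzero, zero_mul, sub_zero]
  rw [heq2]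
  refine (norm_sum_le _ _).trans ?_
  have hTp : t0 / p ≤ T / p := by gcongr
  have : ∀ q, ‖g (rep q) * (((∑' y : L, F ((T / p)⁻¹ • ((y : E) + (p : ℝ)⁻¹ • (rep q : E)))) - Z : ℝ) : ℂ)‖
      ≤ ‖g (rep q)‖ * B q * ((T / p) ^ finrank ℝ E * (T / p)⁻¹) := by
    intro q
    rw [norm_mul, Complex.norm_real, mul_assoc]
    exact mul_le_mul_of_nonneg_left (hB q (T / p) hTp) (norm_nonneg _)
  refine (Finset.sum_le_sum fun q _ => this q).trans (le_of_eq ?_)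
  rw [← Finset.sum_mul, div_pow, inv_div, inv_pow]
  ring

end periodic

end S19

namespace S19

open MeasureTheory Module

/-- A smooth bump function whose integer translates sum to one. -/
noncomputable def tau (t : ℝ) : ℝ := Real.smoothTransition (t + 1) - Real.smoothTransition t

theorem tau_zero_of_le {t : ℝ} (h : t ≤ -1) : tau t = 0 := by
  rw [tau, Real.smoothTransition.zero_of_nonpos (by linarith),
    Real.smoothTransition.zero_of_nonpos (by linarith), sub_zero]

theorem tau_zero_of_ge {t : ℝ} (h : 1 ≤ t) : tau t = 0 := by
  rw [tau, Real.smoothTransition.one_of_one_le (by linarith),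
    Real.smoothTransition.one_of_one_le (by linarith), sub_self]

theorem tau_zero {t : ℝ} (h : 1 ≤ |t|) : tau t = 0 := by
  rcases le_abs.mp h with h | h
  · exact tau_zero_of_ge h
  · exact tau_zero_of_le (by linarith)

theorem tau_nonneg (t : ℝ) : 0 ≤ tau t := by
  rw [tau]
  rcases le_total t 0 with h | h
  · rw [Real.smoothTransition.zero_of_nonpos h, sub_zero]
    exact Real.smoothTransition.nonneg _
  · rw [Real.smoothTransition.one_of_one_le (x := t + 1) (by linarith)]
    linarith [Real.smoothTransition.le_one t]

theorem tau_contDiff {n : ℕ∞} : ContDiff ℝ n tau := by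
  unfold tau
  exact (Real.smoothTransition.contDiff.comp (contDiff_id.add contDiff_const)).sub
    Real.smoothTransition.contDiff

theorem tau_at_zero : tau 0 = 1 := by
  rw [tau, Real.smoothTransition.one_of_one_le (by norm_num),
    Real.smoothTransition.zero_of_nonpos le_rfl, sub_zero]

theorem tau_sum (t : ℝ) : ∑ k ∈ ({-⌊t⌋, -⌊t⌋ - 1} : Finset ℤ), tau (t + k) = 1 := by
  rw [Finset.sum_pair (by omega)]
  push_cast
  have h1 := Int.floor_le t
  have h2 := Int.lt_floor_add_one t
  rw [tau, tau, Real.smoothTransition.one_of_one_le (by linarith),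
    Real.smoothTransition.zero_of_nonpos (x := t + (-(⌊t⌋ : ℝ) - 1)) (by linarith)]
  have : t + (-(⌊t⌋ : ℝ) - 1) + 1 = t + -(⌊t⌋ : ℝ) := by ring
  rw [this]; ring

theorem tau_sum_outside (t : ℝ) {k : ℤ} (hk : k ∉ ({-⌊t⌋, -⌊t⌋ - 1} : Finset ℤ)) :
    tau (t + k) = 0 := by
  have h1 := Int.floor_le t
  have h2 := Int.lt_floor_add_one t
  simp only [Finset.mem_insert, Finset.mem_singleton, not_or] at hk
  rcases lt_or_ge k (-⌊t⌋ - 1) with h | h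
  · apply tau_zero_of_le
    have : (k : ℝ) + 1 ≤ (-⌊t⌋ - 1 : ℤ) := by exact_mod_cast h
    push_cast at this
    linarith
  · apply tau_zero_of_ge
    have h' : -⌊t⌋ + 1 ≤ k := by omega
    have : ((-⌊t⌋ + 1 : ℤ) : ℝ) ≤ k := by exact_mod_cast h'
    push_cast at this
    linarith

theorem tau_prod_hasSum {r : ℕ} (c : Fin r → ℝ) :
    HasSum (fun e : Fin r → ℤ => ∏ i, tau (c i + e i)) 1 := by
  classical
  let t : Fin r → Finset ℤ := fun i => {-⌊c i⌋, -⌊c i⌋ - 1}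
  have h := Finset.prod_univ_sum t (fun i k => tau (c i + k))
  have h1 : ∏ i, ∑ k ∈ t i, tau (c i + k) = 1 := Finset.prod_eq_one fun i _ => tau_sum (c i)
  rw [← h1, h]
  apply hasSum_sum_of_ne_finset_zero
  intro e he
  rw [Fintype.mem_piFinset] at he
  push Not at he
  obtain ⟨i, hi⟩ := he
  exact Finset.prod_eq_zero (Finset.mem_univ i) (tau_sum_outside (c i) hi)

/-- Radial weight. -/
noncomputable def rho (v : ℝ) : ℝ := tau (v + 1)

theorem rho_zero_of_ge {v : ℝ} (h : 0 ≤ v) : rho v = 0 := tau_zero_of_ge (by linarith)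

theorem rho_zero_of_le {v : ℝ} (h : v ≤ -2) : rho v = 0 := tau_zero_of_le (by linarith)

theorem rho_nonneg (v : ℝ) : 0 ≤ rho v := tau_nonneg _

theorem rho_contDiff {n : ℕ∞} : ContDiff ℝ n rho := by
  unfold rho
  exact tau_contDiff.comp (contDiff_id.add contDiff_const)

end S19

namespace S19

open MeasureTheory Module NumberField NumberField.InfinitePlace NumberField.mixedEmbedding
  NumberField.Units NumberField.Units.dirichletUnitTheorem

section weight

open scoped Classical

variable (K : Type*) [Field K] [NumberField K]

/-- Coordinates on the log space with respect to the unit lattice. -/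
noncomputable def coordMap : logSpace K ≃ₗ[ℝ] (Fin (rank K) → ℝ) :=
  ((basisUnitLattice K).ofZLatticeBasis ℝ _).equivFun

/-- The sum of the logs. -/
noncomputable def sumLog : (InfinitePlace K → ℝ) →ₗ[ℝ] ℝ :=
  ∑ w, (mult w : ℝ) • LinearMap.proj w

theorem sumLog_apply (l : InfinitePlace K → ℝ) : sumLog K l = ∑ w, (mult w : ℝ) * l w := by
  simp [sumLog]

/-- The log coordinates. -/
noncomputable def logVec : (InfinitePlace K → ℝ) →ₗ[ℝ] logSpace K :=
  LinearMap.pi fun w => (mult w.val : ℝ) •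
    (LinearMap.proj w.val - (finrank ℚ K : ℝ)⁻¹ • sumLog K)

/-- All coordinates. -/
noncomputable def allCoord : (InfinitePlace K → ℝ) →ₗ[ℝ] ℝ × (Fin (rank K) → ℝ) :=
  (sumLog K).prod ((coordMap K).toLinearMap ∘ₗ logVec K)

theorem allCoord_injective : Function.Injective (allCoord K) := by
  rw [← LinearMap.ker_eq_bot, LinearMap.ker_eq_bot']
  intro l hl
  have h1 : sumLog K l = 0 := congrArg Prod.fst hl
  have h2 : coordMap K (logVec K l) = 0 := congrArg Prod.snd hl
  rw [LinearEquiv.map_eq_zero_iff] at h2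
  have h3 : ∀ w, w ≠ w₀ → l w = 0 := by
    intro w hw
    have := congrFun h2 ⟨w, hw⟩
    simp only [logVec, LinearMap.pi_apply, LinearMap.smul_apply, LinearMap.sub_apply,
      LinearMap.proj_apply, h1, mul_zero, sub_zero, Pi.zero_apply, smul_eq_mul,
      mul_eq_zero, Nat.cast_eq_zero] at this
    exact this.resolve_left mult_ne_zero
  ext w
  by_cases hw : w = w₀
  · rw [sumLog_apply, Finset.sum_eq_single w₀] at h1
    · subst hw
      simpa [mult_ne_zero] using h1
    · intro b _ hb
      rw [h3 b hb, mul_zero]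
    · simp
  · exact h3 w hw

/-- Vector of logs. -/
noncomputable def logs (x : mixedSpace K) : InfinitePlace K → ℝ := fun w =>
  Real.log (normAtPlace w x)

theorem sumLog_logs {x : mixedSpace K} (hx : mixedEmbedding.norm x ≠ 0) :
    sumLog K (logs K x) = Real.log (mixedEmbedding.norm x) := by
  rw [sumLog_apply, mixedEmbedding.norm_apply, Real.log_prod]
  · simp [logs]
  · intro w _
    exact pow_ne_zero _ (mixedEmbedding.norm_ne_zero_iff.mp hx w)

theorem logVec_logs {x : mixedSpace K} (hx : mixedEmbedding.norm x ≠ 0) :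
    logVec K (logs K x) = logMap x := by
  ext w
  simp only [logVec, LinearMap.pi_apply, LinearMap.smul_apply, LinearMap.sub_apply,
      LinearMap.proj_apply, sumLog_logs K hx, logMap_apply, smul_eq_mul, logs]
  ring

/-- Model weight. -/
noncomputable def modelW (z : ℝ × (Fin (rank K) → ℝ)) : ℝ := rho z.1 * ∏ i, tau (z.2 i)

/-- The weight function on the mixed space. -/
noncomputable def weight (x : mixedSpace K) : ℝ :=
  if mixedEmbedding.norm x = 0 then 0 else modelW K (allCoord K (logs K x))

theorem weight_eq {x : mixedSpace K} (hx : mixedEmbedding.norm x ≠ 0) :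
    weight K x = rho (Real.log (mixedEmbedding.norm x)) * ∏ i, tau (coordMap K (logMap x) i) := by
  rw [weight, if_neg hx, modelW]
  have h1 : (allCoord K (logs K x)).1 = sumLog K (logs K x) := rfl
  have h2 : (allCoord K (logs K x)).2 = coordMap K (logVec K (logs K x)) := rfl
  rw [h1, h2, sumLog_logs K hx, logVec_logs K hx]

theorem modelW_support {z : ℝ × (Fin (rank K) → ℝ)} (hz : modelW K z ≠ 0) : ‖z‖ ≤ 2 := by
  rw [modelW] at hz
  obtain ⟨h1, h2⟩ := mul_ne_zero_iff.mp hz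
  rw [Finset.prod_ne_zero_iff] at h2
  rw [Prod.norm_def, max_le_iff]
  constructor
  · rw [Real.norm_eq_abs, abs_le]
    constructor
    · by_contra hcon
      exact h1 (rho_zero_of_le (by linarith))
    · by_contra hcon
      exact h1 (rho_zero_of_ge (by linarith))
  · rw [pi_norm_le_iff_of_nonneg (by norm_num)]
    intro i
    by_contra hcon
    rw [Real.norm_eq_abs] at hcon
    exact h2 i (Finset.mem_univ i) (tau_zero (by linarith))

theorem weight_support : ∃ A : ℝ, ∀ x, weight K x ≠ 0 →
    ∀ w, Real.exp (-A) ≤ normAtPlace w x ∧ normAtPlace w x ≤ Real.exp A := by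
  obtain ⟨c, hc, hanti⟩ := (LinearMap.injective_iff_antilipschitz (allCoord K)).mp
    (allCoord_injective K)
  refine ⟨c * 2, fun x hx w => ?_⟩
  have hn : mixedEmbedding.norm x ≠ 0 := by
    intro h
    apply hx
    rw [weight, if_pos h]
  rw [weight, if_neg hn] at hx
  have h1 := modelW_support K hx
  have h2 : ‖logs K x‖ ≤ c * ‖allCoord K (logs K x)‖ := by
    have := hanti.le_mul_dist (logs K x) 0
    simpa using this
  have h3 : ‖logs K x w‖ ≤ c * 2 := by
    refine (norm_le_pi_norm _ w).trans (h2.trans ?_)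
    gcongr
  have hpos : 0 < normAtPlace w x := lt_of_le_of_ne (normAtPlace_nonneg _ _)
    (mixedEmbedding.norm_ne_zero_iff.mp hn w).symm
  rw [Real.norm_eq_abs, abs_le] at h3
  rw [← Real.le_log_iff_exp_le hpos, ← Real.log_le_iff_le_exp hpos]
  exact h3

theorem normAtPlace_contDiffAt (w : InfinitePlace K) (x : mixedSpace K)
    (hx : normAtPlace w x ≠ 0) : ContDiffAt ℝ 1 (fun y : mixedSpace K => normAtPlace w y) x := by
  by_cases hw : IsReal w
  · have e : (fun y : mixedSpace K => normAtPlace w y) = fun y => ‖y.1 ⟨w, hw⟩‖ := by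
      ext y; exact normAtPlace_apply_of_isReal hw y
    rw [e]
    rw [normAtPlace_apply_of_isReal hw, norm_ne_zero_iff] at hx
    exact ContDiffAt.norm ℝ (by fun_prop) hx
  · rw [not_isReal_iff_isComplex] at hw
    have e : (fun y : mixedSpace K => normAtPlace w y) = fun y => ‖y.2 ⟨w, hw⟩‖ := by
      ext y; exact normAtPlace_apply_of_isComplex hw y
    rw [e]
    rw [normAtPlace_apply_of_isComplex hw, norm_ne_zero_iff] at hx
    exact ContDiffAt.norm ℝ (by fun_prop) hx

theorem modelW_contDiff : ContDiff ℝ 1 (modelW K) := by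
  unfold modelW
  refine ContDiff.mul (rho_contDiff.comp contDiff_fst) ?_
  refine contDiff_prod fun i _ => ?_
  exact tau_contDiff.comp (by fun_prop)

theorem weight_contDiff : ContDiff ℝ 1 (weight K) := by
  rw [contDiff_iff_contDiffAt]
  intro x
  by_cases hx : mixedEmbedding.norm x = 0
  · obtain ⟨w, hw⟩ := mixedEmbedding.norm_eq_zero_iff.mp hx
    obtain ⟨A, hA⟩ := weight_support K
    have : ∀ᶠ y in nhds x, weight K y = 0 := by
      have h1 : ∀ᶠ y in nhds x, normAtPlace w y < Real.exp (-A) := by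
        refine (continuous_normAtPlace w).continuousAt.eventually_lt continuousAt_const ?_
        rw [hw]; exact Real.exp_pos _
      filter_upwards [h1] with y hy
      by_contra hcon
      exact absurd (hA y hcon w).1 (not_le.mpr hy)
    exact contDiffAt_const.congr_of_eventuallyEq this
  · have h1 : ∀ᶠ y in nhds x, mixedEmbedding.norm y ≠ 0 :=
      (mixedEmbedding.continuous_norm K).continuousAt.eventually_ne hx
    have h2 : ContDiffAt ℝ 1 (fun y => modelW K (allCoord K (logs K y))) x := by
      refine (modelW_contDiff K).contDiffAt.comp x ?_
      refine ContDiffAt.comp (f := logs K) (g := allCoord K) x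
        (LinearMap.toContinuousLinearMap (allCoord K)).contDiff.contDiffAt ?_
      rw [contDiffAt_pi]
      intro w
      have := mixedEmbedding.norm_ne_zero_iff.mp hx w
      exact ContDiffAt.log (normAtPlace_contDiffAt K w x this) this
    refine h2.congr_of_eventuallyEq ?_
    filter_upwards [h1] with y hy
    rw [weight, if_neg hy]

theorem weight_bounded : ∃ R : ℝ, 0 ≤ R ∧ ∀ x, R < ‖x‖ → weight K x = 0 := by
  obtain ⟨A, hA⟩ := weight_support K
  refine ⟨Real.exp A, (Real.exp_pos _).le, fun x hx => ?_⟩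
  by_contra hcon
  apply absurd hx
  rw [not_lt, norm_eq_sup'_normAtPlace]
  exact Finset.sup'_le _ _ fun w _ => (hA x hcon w).2

theorem weight_lipschitz : ∃ C : NNReal, LipschitzWith C (weight K) := by
  obtain ⟨R, -, hR⟩ := weight_bounded K
  have hc : HasCompactSupport (weight K) := by
    refine HasCompactSupport.intro (isCompact_closedBall (0 : mixedSpace K) R) ?_
    intro y hy
    apply hR
    simpa using hy
  exact ContDiff.lipschitzWith_of_hasCompactSupport hc (weight_contDiff K) one_ne_zero

theorem coordMap_logEmbedding (e : Fin (rank K) → ℤ) (ζ : torsion K) :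
    coordMap K (logEmbedding K (Additive.ofMul (ζ * ∏ i, fundSystem K i ^ e i))) =
      fun i => (e i : ℝ) := by
  classical
  have h1 : logEmbedding K (Additive.ofMul (ζ * ∏ i, fundSystem K i ^ e i : (𝓞 K)ˣ)) =
      ∑ i, (e i : ℝ) • (basisUnitLattice K).ofZLatticeBasis ℝ _ i := by
    rw [ofMul_mul, map_add, logEmbedding_eq_zero_iff.mpr ζ.2, zero_add, ofMul_prod, map_sum]
    refine Finset.sum_congr rfl fun i _ => ?_
    rw [ofMul_zpow, map_zsmul, logEmbedding_fundSystem, Basis.ofZLatticeBasis_apply,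
      Int.cast_smul_eq_zsmul]
  rw [h1, coordMap, map_sum]
  ext j
  simp [Finsupp.single_apply]

theorem hasSum_aux {A B : Type*} [Finite A] (G : B → ℝ) (hG : ∀ b, 0 ≤ G b) (h1 : HasSum G 1) (v : ℝ) :
    HasSum (fun z : A × B => v * G z.2) (Nat.card A * v) := by
  have := Fintype.ofFinite A
  have h2 : HasSum (fun _ : A => (1 : ℝ)) (Nat.card A) := by
    have h := hasSum_fintype (fun _ : A => (1 : ℝ))
    simpa [Nat.card_eq_fintype_card] using h
  have h3 := h2.mul h1 (h2.summable.mul_of_nonneg h1.summable (fun _ => zero_le_one) hG)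
  have h4 := h3.mul_left v
  simp only [one_mul, mul_one] at h4
  rw [mul_comm]
  exact h4

/-- Decomposition of units. -/
noncomputable def unitDec (z : torsion K × (Fin (rank K) → ℤ)) : (𝓞 K)ˣ :=
  z.1 * ∏ i, fundSystem K i ^ z.2 i

theorem unitDec_bijective : Function.Bijective (unitDec K) := by
  rw [Function.bijective_iff_existsUnique]
  intro u
  obtain ⟨z, hz, hz'⟩ := exist_unique_eq_mul_prod K u
  exact ⟨z, hz.symm, fun y hy => hz' y hy.symm⟩

theorem weight_unitDec {x : mixedSpace K} (hx : mixedEmbedding.norm x ≠ 0)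
    (z : torsion K × (Fin (rank K) → ℤ)) :
    weight K (unitDec K z • x) = rho (Real.log (mixedEmbedding.norm x)) *
      ∏ i, tau (coordMap K (logMap x) i + z.2 i) := by
  rw [weight_eq K (by rwa [norm_unit_smul]), norm_unit_smul, logMap_unit_smul _ hx, map_add,
    unitDec, coordMap_logEmbedding]
  congr 1
  refine Finset.prod_congr rfl fun i _ => ?_
  rw [Pi.add_apply, add_comm]

theorem weight_unit_sum {x : mixedSpace K} (hx : mixedEmbedding.norm x ≠ 0) :
    HasSum (fun u : (𝓞 K)ˣ => weight K (u • x))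
      (torsionOrder K * rho (Real.log (mixedEmbedding.norm x))) := by
  rw [← (Equiv.ofBijective _ (unitDec_bijective K)).hasSum_iff]
  have e : (fun u : (𝓞 K)ˣ => weight K (u • x)) ∘ (Equiv.ofBijective _ (unitDec_bijective K)) =
      fun z => rho (Real.log (mixedEmbedding.norm x)) *
        ∏ i, tau (coordMap K (logMap x) i + z.2 i) := by
    ext z; exact weight_unitDec K hx z
  rw [e]
  exact hasSum_aux (A := torsion K)
    (fun e : Fin (rank K) → ℤ => ∏ i, tau (coordMap K (logMap x) i + e i))
    (fun e => Finset.prod_nonneg fun i _ => tau_nonneg _) (tau_prod_hasSum _) _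

end weight

end S19

namespace S19

open Module NumberField nonZeroDivisors

section ideals

variable (K : Type*) [Field K] [NumberField K]

theorem norm_congr (p : ℕ) (y z : 𝓞 K) :
    ((Algebra.norm ℤ (y + (p : ℤ) • z) : ℤ) : ZMod p) = ((Algebra.norm ℤ y : ℤ) : ZMod p) := by
  classical
  let b := RingOfIntegers.basis K
  have h : ∀ y : 𝓞 K, ((Algebra.norm ℤ y : ℤ) : ZMod p) =
      ((Int.castRingHom (ZMod p)).mapMatrix (Algebra.leftMulMatrix b y)).det := by
    intro y
    rw [Algebra.norm_eq_matrix_det b y, ← RingHom.map_det]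
    rfl
  rw [h, h]
  congr 1
  rw [map_add, map_zsmul]
  ext i j
  simp only [RingHom.mapMatrix_apply, Matrix.map_apply, Matrix.add_apply, Matrix.smul_apply]
  simp

theorem norm_zsmul (a : ℤ) (y : 𝓞 K) :
    Algebra.norm ℤ (a • y) = a ^ finrank ℚ K * Algebra.norm ℤ y := by
  rw [Algebra.smul_def, map_mul, Algebra.norm_algebraMap, RingOfIntegers.rank]

theorem exists_coprime_rep (p : ℕ) (hp : p.Prime) (c : ClassGroup (𝓞 K)) :
    ∃ J : (Ideal (𝓞 K))⁰, ClassGroup.mk0 J = c ∧ (Ideal.absNorm (J : Ideal (𝓞 K))).Coprime p := by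
  obtain ⟨A, hA⟩ := ClassGroup.mk0_surjective c⁻¹
  have hA0 : (A : Ideal (𝓞 K)) ≠ 0 := mem_nonZeroDivisors_iff_ne_zero.mp A.2
  have hp0 : (p : 𝓞 K) ≠ 0 := by exact_mod_cast hp.ne_zero
  set P : Ideal (𝓞 K) := Ideal.span {(p : 𝓞 K)} with hP
  have hP0 : P ≠ 0 := by rw [hP, Ne, Ideal.zero_eq_bot, Ideal.span_singleton_eq_bot]; exact hp0
  obtain ⟨y, hy⟩ := IsDedekindDomain.exists_sup_span_eq (I := (A : Ideal (𝓞 K)) * P)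
    (J := A) Ideal.mul_le_left (mul_ne_zero hA0 hP0)
  have hyA : y ∈ (A : Ideal (𝓞 K)) := by
    rw [← hy]; exact Ideal.mem_sup_right (Ideal.mem_span_singleton_self y)
  obtain ⟨J, hJ⟩ := Ideal.dvd_span_singleton.mpr hyA
  have hcop : P ⊔ J = ⊤ := by
    have h1 : (A : Ideal (𝓞 K)) * (P ⊔ J) = A * ⊤ := by
      rw [Ideal.mul_sup, ← hJ, hy, Ideal.mul_top]
    exact mul_left_cancel₀ hA0 h1
  have hy0 : y ≠ 0 := by
    rintro rfl
    have h0 : (A : Ideal (𝓞 K)) * J = 0 := by rw [← hJ]; simp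
    have hJ0 : J = 0 := (mul_eq_zero.mp h0).resolve_left hA0
    rw [hJ0, Ideal.zero_eq_bot, sup_bot_eq] at hcop
    have := Ideal.absNorm_eq_one_iff.mpr hcop
    rw [hP, Ideal.absNorm_span_natCast, RingOfIntegers.rank] at this
    exact hp.one_lt.ne' ((pow_eq_one_iff.mp this).resolve_right finrank_pos.ne')
  have hJ0 : J ≠ 0 := by
    rintro rfl
    rw [mul_zero, Ideal.zero_eq_bot, Ideal.span_singleton_eq_bot] at hJ
    exact hy0 hJ
  refine ⟨⟨J, mem_nonZeroDivisors_of_ne_zero hJ0⟩, ?_, ?_⟩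
  · have : ClassGroup.mk0 (A * ⟨J, mem_nonZeroDivisors_of_ne_zero hJ0⟩ : (Ideal (𝓞 K))⁰) = 1 := by
      rw [ClassGroup.mk0_eq_one_iff (SetLike.coe_mem _)]
      refine ⟨⟨y, ?_⟩⟩
      simp only [Submonoid.coe_mul]
      rw [← hJ]
    rw [map_mul, hA] at this
    exact (inv_mul_eq_one.mp this).symm
  · rw [Nat.coprime_comm, Nat.Prime.coprime_iff_not_dvd hp]
    intro hdvd
    have h1 : (1 : 𝓞 K) ∈ P ⊔ J := by rw [hcop]; trivial
    obtain ⟨u, hu, v, hv, huv⟩ := Submodule.mem_sup.mp h1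
    obtain ⟨z, rfl⟩ := Ideal.mem_span_singleton.mp hu
    have hv1 : v = 1 + (p : ℤ) • (-z) := by
      rw [← huv]; simp
    have h2 := Ideal.absNorm_dvd_norm_of_mem hv
    have h3 : (p : ℤ) ∣ Algebra.norm ℤ v := (Int.natCast_dvd_natCast.mpr hdvd).trans h2
    have h4 := norm_congr K p 1 (-z)
    rw [← hv1, (ZMod.intCast_zmod_eq_zero_iff_dvd _ _).mpr h3, map_one] at h4
    have := Fact.mk hp.one_lt
    simp at h4

theorem exists_gen {J : (Ideal (𝓞 K))⁰} {c : ClassGroup (𝓞 K)} (hJ : ClassGroup.mk0 J = c⁻¹)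
    (I : {I : (Ideal (𝓞 K))⁰ // ClassGroup.mk0 I = c}) :
    ∃ g : 𝓞 K, Ideal.span {g} = (I.1 : Ideal (𝓞 K)) * J := by
  have : ClassGroup.mk0 (I.1 * J) = 1 := by rw [map_mul, I.2, hJ, mul_inv_cancel]
  rw [ClassGroup.mk0_eq_one_iff (SetLike.coe_mem _)] at this
  obtain ⟨⟨g, hg⟩⟩ := this
  exact ⟨g, by simpa using hg.symm⟩

/-- A chosen generator of `I * J`. -/
noncomputable def gen {J : (Ideal (𝓞 K))⁰} {c : ClassGroup (𝓞 K)} (hJ : ClassGroup.mk0 J = c⁻¹)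
    (I : {I : (Ideal (𝓞 K))⁰ // ClassGroup.mk0 I = c}) : 𝓞 K := (exists_gen K hJ I).choose

theorem gen_spec {J : (Ideal (𝓞 K))⁰} {c : ClassGroup (𝓞 K)} (hJ : ClassGroup.mk0 J = c⁻¹)
    (I : {I : (Ideal (𝓞 K))⁰ // ClassGroup.mk0 I = c}) :
    Ideal.span {gen K hJ I} = (I.1 : Ideal (𝓞 K)) * J := (exists_gen K hJ I).choose_spec

theorem gen_mul_injective {J : (Ideal (𝓞 K))⁰} {c : ClassGroup (𝓞 K)}
    (hJ : ClassGroup.mk0 J = c⁻¹) :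
    Function.Injective fun z : {I : (Ideal (𝓞 K))⁰ // ClassGroup.mk0 I = c} × (𝓞 K)ˣ =>
      (z.2 : 𝓞 K) * gen K hJ z.1 := by
  rintro ⟨I, u⟩ ⟨I', u'⟩ h
  simp only at h
  have hJ0 : (J : Ideal (𝓞 K)) ≠ 0 := mem_nonZeroDivisors_iff_ne_zero.mp J.2
  have hs : ∀ (I : {I : (Ideal (𝓞 K))⁰ // ClassGroup.mk0 I = c}) (u : (𝓞 K)ˣ),
      Ideal.span {(u : 𝓞 K) * gen K hJ I} = (I.1 : Ideal (𝓞 K)) * J := fun I u => by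
    rw [Ideal.span_singleton_mul_left_unit u.isUnit, gen_spec]
  have h1 : (I.1 : Ideal (𝓞 K)) * J = (I'.1 : Ideal (𝓞 K)) * J := by
    rw [← hs I u, h, hs]
  have h2 : I = I' := Subtype.ext (Subtype.ext (mul_right_cancel₀ hJ0 h1))
  subst h2
  have hg : gen K hJ I ≠ 0 := by
    intro h0
    have := gen_spec K hJ I
    rw [h0, Ideal.span_singleton_eq_bot.mpr rfl] at this
    exact mul_ne_zero (mem_nonZeroDivisors_iff_ne_zero.mp I.1.2) hJ0 this.symm
  have := mul_right_cancel₀ hg h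
  rw [Units.ext this]

theorem gen_mul_surj {J : (Ideal (𝓞 K))⁰} {c : ClassGroup (𝓞 K)}
    (hJ : ClassGroup.mk0 J = c⁻¹) {x : 𝓞 K} (hx : x ∈ (J : Ideal (𝓞 K))) (hx0 : x ≠ 0) :
    ∃ z : {I : (Ideal (𝓞 K))⁰ // ClassGroup.mk0 I = c} × (𝓞 K)ˣ,
      (z.2 : 𝓞 K) * gen K hJ z.1 = x := by
  obtain ⟨I, hI⟩ := Ideal.dvd_span_singleton.mpr hx
  have hI0 : I ≠ 0 := by
    rintro rfl
    rw [mul_zero, Ideal.zero_eq_bot, Ideal.span_singleton_eq_bot] at hI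
    exact hx0 hI
  let I' : (Ideal (𝓞 K))⁰ := ⟨I, mem_nonZeroDivisors_of_ne_zero hI0⟩
  have h1 : ClassGroup.mk0 (J * I') = 1 := by
    rw [ClassGroup.mk0_eq_one_iff (SetLike.coe_mem _)]
    refine ⟨⟨x, ?_⟩⟩
    simp only [Submonoid.coe_mul, I']
    rw [← hI]
  have h2 : ClassGroup.mk0 I' = c := by
    rw [map_mul, hJ] at h1
    exact (inv_mul_eq_one.mp h1).symm
  have h3 := gen_spec K hJ ⟨I', h2⟩
  have h4 : Ideal.span {gen K hJ ⟨I', h2⟩} = Ideal.span {x} := by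
    rw [h3, hI, mul_comm]
  obtain ⟨u, hu⟩ := Ideal.span_singleton_eq_span_singleton.mp h4
  exact ⟨(⟨I', h2⟩, u), by rw [mul_comm]; exact hu⟩

theorem gen_norm {J : (Ideal (𝓞 K))⁰} {c : ClassGroup (𝓞 K)} (hJ : ClassGroup.mk0 J = c⁻¹)
    (z : {I : (Ideal (𝓞 K))⁰ // ClassGroup.mk0 I = c} × (𝓞 K)ˣ) :
    (Algebra.norm ℤ ((z.2 : 𝓞 K) * gen K hJ z.1)).natAbs =
      Ideal.absNorm (z.1.1 : Ideal (𝓞 K)) * Ideal.absNorm (J : Ideal (𝓞 K)) := by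
  rw [← map_mul, ← gen_spec K hJ, ← Ideal.absNorm_span_singleton,
    Ideal.span_singleton_mul_left_unit z.2.isUnit]

end ideals

end S19

namespace S19

open MeasureTheory Module NumberField NumberField.InfinitePlace NumberField.mixedEmbedding
  NumberField.Units NumberField.Units.dirichletUnitTheorem nonZeroDivisors

section sums

open scoped Classical

variable (K : Type*) [Field K] [NumberField K]

/-- The lattice attached to an ideal. -/
noncomputable abbrev latt (J : (Ideal (𝓞 K))⁰) : Submodule ℤ (mixedSpace K) :=
  idealLattice K (FractionalIdeal.mk0 K J)

variable {K}

theorem mem_latt {J : (Ideal (𝓞 K))⁰} {x : mixedSpace K} :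
    x ∈ latt K J ↔ ∃ y : 𝓞 K, y ∈ (J : Ideal (𝓞 K)) ∧ mixedEmbedding K (y : K) = x := by
  rw [mem_idealLattice]
  constructor
  · rintro ⟨y, hy, rfl⟩
    rw [FractionalIdeal.coe_mk0] at hy
    obtain ⟨z, hz, rfl⟩ := (FractionalIdeal.mem_coeIdeal _).mp hy
    exact ⟨z, hz, rfl⟩
  · rintro ⟨y, hy, rfl⟩
    refine ⟨_, ?_, rfl⟩
    rw [FractionalIdeal.coe_mk0]
    exact (FractionalIdeal.mem_coeIdeal _).mpr ⟨y, hy, rfl⟩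

/-- The algebraic integer behind a lattice point. -/
noncomputable def ofL {J : (Ideal (𝓞 K))⁰} (x : latt K J) : 𝓞 K := (mem_latt.mp x.2).choose

theorem ofL_mem {J : (Ideal (𝓞 K))⁰} (x : latt K J) : ofL x ∈ (J : Ideal (𝓞 K)) :=
  (mem_latt.mp x.2).choose_spec.1

theorem ofL_spec {J : (Ideal (𝓞 K))⁰} (x : latt K J) : mixedEmbedding K (ofL x : K) = x :=
  (mem_latt.mp x.2).choose_spec.2

theorem ofL_unique {J : (Ideal (𝓞 K))⁰} (x : latt K J) (y : 𝓞 K)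
    (h : mixedEmbedding K (y : K) = x) : ofL x = y := by
  apply RingOfIntegers.coe_injective
  apply mixedEmbedding_injective K
  rw [ofL_spec, h]

theorem ofL_add_zsmul {J : (Ideal (𝓞 K))⁰} (x y : latt K J) (a : ℤ) :
    ofL (x + a • y) = ofL x + a • ofL y := by
  apply ofL_unique
  simp [ofL_spec]

theorem ofL_zsmul {J : (Ideal (𝓞 K))⁰} (x : latt K J) (a : ℤ) :
    ofL (a • x) = a • ofL x := by
  apply ofL_unique
  simp [ofL_spec]

theorem unit_mul_gen_mem {J : (Ideal (𝓞 K))⁰} {c : ClassGroup (𝓞 K)}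
    (hJ : ClassGroup.mk0 J = c⁻¹)
    (z : {I : (Ideal (𝓞 K))⁰ // ClassGroup.mk0 I = c} × (𝓞 K)ˣ) :
    (z.2 : 𝓞 K) * gen K hJ z.1 ∈ (J : Ideal (𝓞 K)) := by
  apply Ideal.mul_mem_left
  have : gen K hJ z.1 ∈ (z.1.1 : Ideal (𝓞 K)) * J := by
    rw [← gen_spec K hJ]; exact Ideal.mem_span_singleton_self _
  exact Ideal.mul_le_right this

/-- Parametrization of nonzero lattice points. -/
noncomputable def par {J : (Ideal (𝓞 K))⁰} {c : ClassGroup (𝓞 K)} (hJ : ClassGroup.mk0 J = c⁻¹)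
    (z : {I : (Ideal (𝓞 K))⁰ // ClassGroup.mk0 I = c} × (𝓞 K)ˣ) : latt K J :=
  ⟨mixedEmbedding K (((z.2 : 𝓞 K) * gen K hJ z.1 : 𝓞 K) : K),
    mem_latt.mpr ⟨_, unit_mul_gen_mem hJ z, rfl⟩⟩

theorem ofL_par {J : (Ideal (𝓞 K))⁰} {c : ClassGroup (𝓞 K)} (hJ : ClassGroup.mk0 J = c⁻¹)
    (z : {I : (Ideal (𝓞 K))⁰ // ClassGroup.mk0 I = c} × (𝓞 K)ˣ) :
    ofL (par hJ z) = (z.2 : 𝓞 K) * gen K hJ z.1 := ofL_unique _ _ rfl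

theorem par_injective {J : (Ideal (𝓞 K))⁰} {c : ClassGroup (𝓞 K)} (hJ : ClassGroup.mk0 J = c⁻¹) :
    Function.Injective (par hJ) := by
  intro z z' h
  apply gen_mul_injective K hJ
  simp only
  rw [← ofL_par, h, ofL_par]

theorem par_surj {J : (Ideal (𝓞 K))⁰} {c : ClassGroup (𝓞 K)} (hJ : ClassGroup.mk0 J = c⁻¹)
    (x : latt K J) (hx : x ≠ 0) : x ∈ Set.range (par hJ) := by
  have h0 : ofL x ≠ 0 := by
    intro h
    apply hx
    apply Subtype.ext
    rw [← ofL_spec x, h]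
    simp
  obtain ⟨z, hz⟩ := gen_mul_surj K hJ (ofL_mem x) h0
  refine ⟨z, Subtype.ext ?_⟩
  rw [← ofL_spec x, ← hz]
  rfl

theorem par_eq {J : (Ideal (𝓞 K))⁰} {c : ClassGroup (𝓞 K)} (hJ : ClassGroup.mk0 J = c⁻¹)
    (I : {I : (Ideal (𝓞 K))⁰ // ClassGroup.mk0 I = c}) (u : (𝓞 K)ˣ) :
    (par hJ (I, u) : mixedSpace K) = u • mixedEmbedding K (gen K hJ I : K) := by
  simp [par, unitSMul_smul]

theorem smul_unit_comm (t : ℝ) (u : (𝓞 K)ˣ) (x : mixedSpace K) : t • (u • x) = u • (t • x) := by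
  rw [unitSMul_smul, unitSMul_smul, mul_smul_comm]

theorem norm_gen {J : (Ideal (𝓞 K))⁰} {c : ClassGroup (𝓞 K)} (hJ : ClassGroup.mk0 J = c⁻¹)
    (I : {I : (Ideal (𝓞 K))⁰ // ClassGroup.mk0 I = c}) :
    mixedEmbedding.norm (mixedEmbedding K (gen K hJ I : K)) =
      Ideal.absNorm (I.1 : Ideal (𝓞 K)) * Ideal.absNorm (J : Ideal (𝓞 K)) := by
  have h := gen_norm K hJ (I, 1)
  simp only [Units.val_one, one_mul] at h
  rw [mixedEmbedding.norm_eq_norm, ← Algebra.coe_norm_int, ← Nat.cast_mul, ← h, ← Int.cast_abs,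
    Rat.cast_intCast, Int.abs_eq_natAbs, Int.cast_natCast]

theorem weight_zero : weight K 0 = 0 := by
  rw [weight, if_pos (map_zero _)]

theorem absNorm_pos (I : (Ideal (𝓞 K))⁰) : 0 < Ideal.absNorm (I : Ideal (𝓞 K)) :=
  Nat.pos_of_ne_zero (Ideal.absNorm_ne_zero_of_nonZeroDivisors I)

/-- The scaling parameter. -/
noncomputable def scal (J : (Ideal (𝓞 K))⁰) (T : ℝ) : ℝ :=
  ((Ideal.absNorm (J : Ideal (𝓞 K)) : ℝ) * T) ^ ((finrank ℚ K : ℝ)⁻¹)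

theorem scal_pow (J : (Ideal (𝓞 K))⁰) {T : ℝ} (hT : 0 < T) :
    scal J T ^ finrank ℚ K = (Ideal.absNorm (J : Ideal (𝓞 K)) : ℝ) * T := by
  rw [scal, Real.rpow_inv_natCast_pow (by positivity) finrank_pos.ne']

theorem scal_pos (J : (Ideal (𝓞 K))⁰) {T : ℝ} (hT : 0 < T) : 0 < scal J T := by
  have := absNorm_pos J
  rw [scal]; positivity

theorem scal_one_le (J : (Ideal (𝓞 K))⁰) {T : ℝ} (hT : 1 ≤ T) : 1 ≤ scal J T := by
  have : (1 : ℝ) ≤ Ideal.absNorm (J : Ideal (𝓞 K)) := by exact_mod_cast absNorm_pos J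
  rw [scal]
  apply Real.one_le_rpow (by nlinarith) (by positivity)

theorem class_sum {J : (Ideal (𝓞 K))⁰} {c : ClassGroup (𝓞 K)} (hJ : ClassGroup.mk0 J = c⁻¹)
    (θ : ℕ → ℂ) (hθ : ∀ a b, θ (a * b) = θ a * θ b) (g : latt K J → ℂ)
    (hg : ∀ x, g x = θ (Algebra.norm ℤ (ofL x)).natAbs) {T : ℝ} (hT : 0 < T) :
    ∑' x : latt K J, g x * (weight K ((scal J T)⁻¹ • (x : mixedSpace K)) : ℂ) =
      torsionOrder K * θ (Ideal.absNorm (J : Ideal (𝓞 K))) *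
      ∑' I : {I : (Ideal (𝓞 K))⁰ // ClassGroup.mk0 I = c},
        θ (Ideal.absNorm (I.1 : Ideal (𝓞 K))) *
          (rho (Real.log (Ideal.absNorm (I.1 : Ideal (𝓞 K)) / T)) : ℂ) := by
  set f : latt K J → ℂ := fun x => g x * (weight K ((scal J T)⁻¹ • (x : mixedSpace K)) : ℂ) with hf
  have hsc := scal_pos J hT
  obtain ⟨R, hR0, hR⟩ := weight_bounded K
  have hsupp : (Function.support f).Finite := by
    refine (finite_support_lattice (latt K J) hR 0 hsc).subset ?_
    intro x hx hx'
    apply hx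
    simp only [add_zero] at hx'
    simp [hf, hx']
  have hsum : Summable f := summable_of_hasFiniteSupport hsupp
  have h1 : ∑' z, f (par hJ z) = ∑' x, f x := by
    refine (par_injective hJ).tsum_eq ?_
    intro x hx
    apply par_surj
    rintro rfl
    apply hx
    simp [hf, weight_zero]
  have hsum' : Summable fun z => f (par hJ z) := hsum.comp_injective (par_injective hJ)
  rw [← h1, hsum'.tsum_prod, ← tsum_mul_left]
  refine tsum_congr fun I => ?_
  have hn : mixedEmbedding.norm ((scal J T)⁻¹ • mixedEmbedding K (gen K hJ I : K)) =
      Ideal.absNorm (I.1 : Ideal (𝓞 K)) / T := by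
    rw [mixedEmbedding.norm_smul, norm_gen, abs_of_pos (inv_pos.mpr hsc), inv_pow, scal_pow J hT]
    have : (0 : ℝ) < Ideal.absNorm (J : Ideal (𝓞 K)) := by exact_mod_cast absNorm_pos J
    field_simp
  have hn0 : mixedEmbedding.norm ((scal J T)⁻¹ • mixedEmbedding K (gen K hJ I : K)) ≠ 0 := by
    rw [hn]
    have : (0 : ℝ) < Ideal.absNorm (I.1 : Ideal (𝓞 K)) := by exact_mod_cast absNorm_pos I.1
    positivity
  have h2 := weight_unit_sum K hn0
  have h3 : ∀ u : (𝓞 K)ˣ, f (par hJ (I, u)) =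
      θ (Ideal.absNorm (I.1 : Ideal (𝓞 K))) * θ (Ideal.absNorm (J : Ideal (𝓞 K))) *
      (weight K (u • ((scal J T)⁻¹ • mixedEmbedding K (gen K hJ I : K))) : ℂ) := by
    intro u
    simp only [hf]
    rw [hg, ofL_par, gen_norm, hθ, par_eq, smul_unit_comm]
  simp only [h3]
  rw [tsum_mul_left, ← Complex.ofReal_tsum, h2.tsum_eq, hn]
  push_cast
  ring

end sums

end S19

namespace S19

open MeasureTheory Module NumberField NumberField.InfinitePlace NumberField.mixedEmbedding
  NumberField.Units NumberField.Units.dirichletUnitTheorem nonZeroDivisors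

section asymp

open scoped Classical

variable (K : Type*) [Field K] [NumberField K]

/-- The error term. -/
noncomputable def err (T : ℝ) : ℝ := T * T ^ (-(finrank ℚ K : ℝ)⁻¹)

variable {K}

theorem err_pos {T : ℝ} (hT : 0 < T) : 0 < err K T := by rw [err]; positivity

theorem scal_err (J : (Ideal (𝓞 K))⁰) {T : ℝ} (hT : 1 ≤ T) (B : ℝ) :
    B * (scal J T ^ finrank ℝ (mixedSpace K) * (scal J T)⁻¹) ≤
      |B| * Ideal.absNorm (J : Ideal (𝓞 K)) * err K T := by
  have hT0 : 0 < T := by linarith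
  have hJ1 : (1 : ℝ) ≤ Ideal.absNorm (J : Ideal (𝓞 K)) := by exact_mod_cast absNorm_pos J
  have h2 : (scal J T)⁻¹ ≤ T ^ (-(finrank ℚ K : ℝ)⁻¹) := by
    rw [scal, ← Real.rpow_neg (by positivity)]
    exact Real.rpow_le_rpow_of_nonpos hT0 (by nlinarith) (by simp)
  have hs := scal_pos J hT0
  rw [mixedEmbedding.finrank, scal_pow J hT0, err]
  calc B * (Ideal.absNorm (J : Ideal (𝓞 K)) * T * (scal J T)⁻¹)
      ≤ |B| * (Ideal.absNorm (J : Ideal (𝓞 K)) * T * (scal J T)⁻¹) := by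
        gcongr; exact le_abs_self B
    _ ≤ |B| * (Ideal.absNorm (J : Ideal (𝓞 K)) * T * T ^ (-(finrank ℚ K : ℝ)⁻¹)) := by gcongr
    _ = _ := by ring

variable (K) in
theorem class_asymp_one : ∃ κ : ℝ, ∀ c : ClassGroup (𝓞 K), ∃ B : ℝ, ∀ T : ℝ, 1 ≤ T →
    ‖∑' I : {I : (Ideal (𝓞 K))⁰ // ClassGroup.mk0 I = c},
        (rho (Real.log (Ideal.absNorm (I.1 : Ideal (𝓞 K)) / T)) : ℂ) - κ * T‖ ≤ B * err K T := by
  obtain ⟨C, hC⟩ := weight_lipschitz K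
  obtain ⟨R, hR0, hR⟩ := weight_bounded K
  have hw : (0 : ℝ) < torsionOrder K := by exact_mod_cast torsionOrder_pos K
  refine ⟨(torsionOrder K : ℝ)⁻¹ * ((∫ x, weight K x) /
    ((2⁻¹) ^ nrComplexPlaces K * √|discr K|)), fun c => ?_⟩
  obtain ⟨J, hJ⟩ := ClassGroup.mk0_surjective c⁻¹
  obtain ⟨B, hB⟩ := lattice_sum volume (latt K J) (weight K) C hC R hR0 hR 0 1 one_pos
  refine ⟨(torsionOrder K : ℝ)⁻¹ * (|B| * Ideal.absNorm (J : Ideal (𝓞 K))), fun T hT => ?_⟩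
  have hT0 : 0 < T := by linarith
  have h1 := hB (scal J T) (scal_one_le J hT)
  replace h1 := h1.trans (scal_err J hT B)
  have h2 := class_sum hJ (fun _ => 1) (fun _ _ => by simp) (fun _ => 1) (fun _ => rfl) hT0
  simp only [one_mul, mul_one] at h2
  have hcov := mixedEmbedding.covolume_idealLattice K (FractionalIdeal.mk0 K J)
  rw [FractionalIdeal.coe_mk0, FractionalIdeal.coeIdeal_absNorm, Rat.cast_natCast] at hcov
  have hJ1 : (0 : ℝ) < Ideal.absNorm (J : Ideal (𝓞 K)) := by exact_mod_cast absNorm_pos J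
  rw [mixedEmbedding.finrank, scal_pow J hT0, hcov] at h1
  simp only [add_zero] at h1
  set S := ∑' I : {I : (Ideal (𝓞 K))⁰ // ClassGroup.mk0 I = c},
        (rho (Real.log (Ideal.absNorm (I.1 : Ideal (𝓞 K)) / T)) : ℂ) with hS
  rw [← Complex.ofReal_tsum] at h2
  set S' := ∑' x : latt K J, weight K ((scal J T)⁻¹ • (x : mixedSpace K)) with hS'
  have h3 : S = (torsionOrder K : ℂ)⁻¹ * (S' : ℂ) := by
    rw [h2, inv_mul_cancel_left₀]
    exact_mod_cast hw.ne'
  have hd : (0 : ℝ) < √|(discr K : ℝ)| := Real.sqrt_pos.mpr (abs_pos.mpr (by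
    exact_mod_cast discr_ne_zero K))
  have h4 : S - (((torsionOrder K : ℝ)⁻¹ * ((∫ x, weight K x) /
    ((2⁻¹) ^ nrComplexPlaces K * √|(discr K : ℝ)|)) : ℝ) : ℂ) * T =
    (((torsionOrder K : ℝ)⁻¹ * (S' - Ideal.absNorm (J : Ideal (𝓞 K)) * T * ((∫ x, weight K x) /
      (Ideal.absNorm (J : Ideal (𝓞 K)) * 2⁻¹ ^ nrComplexPlaces K * √|(discr K : ℝ)|))) : ℝ) : ℂ) := by
    have e : (Ideal.absNorm (J : Ideal (𝓞 K)) : ℝ) * T * ((∫ x, weight K x) /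
      (Ideal.absNorm (J : Ideal (𝓞 K)) * 2⁻¹ ^ nrComplexPlaces K * √|(discr K : ℝ)|)) =
      ((∫ x, weight K x) / ((2⁻¹) ^ nrComplexPlaces K * √|(discr K : ℝ)|)) * T := by
      field_simp
    rw [e, h3]
    push_cast
    ring
  rw [h4, Complex.norm_real, Real.norm_eq_abs, abs_mul, abs_of_pos (inv_pos.mpr hw)]
  rw [mul_assoc (torsionOrder K : ℝ)⁻¹]
  exact mul_le_mul_of_nonneg_left h1 (inv_pos.mpr hw).le

theorem class_asymp_char (p : ℕ) (hp : p.Prime) (ψ : DirichletCharacter ℂ p) (heven : ψ (-1) = 1)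
    (a : ℤ) (ha : IsCoprime a (p : ℤ)) (hψ : ψ a ^ finrank ℚ K ≠ 1) (c : ClassGroup (𝓞 K)) :
    ∃ B : ℝ, ∀ T : ℝ, 1 ≤ T →
    ‖∑' I : {I : (Ideal (𝓞 K))⁰ // ClassGroup.mk0 I = c},
        ψ (Ideal.absNorm (I.1 : Ideal (𝓞 K))) *
        (rho (Real.log (Ideal.absNorm (I.1 : Ideal (𝓞 K)) / T)) : ℂ)‖ ≤ B * err K T := by
  obtain ⟨C, hC⟩ := weight_lipschitz K
  obtain ⟨R, hR0, hR⟩ := weight_bounded K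
  have hw : (0 : ℝ) < torsionOrder K := by exact_mod_cast torsionOrder_pos K
  obtain ⟨J, hJ, hJp⟩ := exists_coprime_rep K p hp c⁻¹
  have hJu : ψ (Ideal.absNorm (J : Ideal (𝓞 K))) ≠ 0 := by
    have : IsUnit ((Ideal.absNorm (J : Ideal (𝓞 K)) : ℕ) : ZMod p) :=
      (ZMod.isUnit_iff_coprime _ _).mpr hJp
    exact (this.map ψ).ne_zero
  have hnat : ∀ m : ℤ, ψ ((m.natAbs : ℕ) : ZMod p) = ψ (m : ZMod p) := by
    intro m
    rcases Int.natAbs_eq m with h | h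
    · conv_rhs => rw [h, Int.cast_natCast]
    · conv_rhs => rw [h, Int.cast_neg, Int.cast_natCast, ← neg_one_mul, map_mul, heven, one_mul]
  let g : latt K J → ℂ := fun x => ψ ((Algebra.norm ℤ (ofL x) : ℤ) : ZMod p)
  obtain ⟨B, hB⟩ := periodic_zero (latt K J) (weight K) C hC R hR0 hR 1 one_pos p hp.pos g
    (fun x y => by
      simp only [g]
      rw [ofL_add_zsmul, norm_congr]) a ha (ψ a ^ finrank ℚ K) hψ
    (fun x => by
      simp only [g]
      rw [ofL_zsmul, norm_zsmul]
      push_cast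
      rw [map_mul, map_pow])
  refine ⟨(torsionOrder K : ℝ)⁻¹ * ‖ψ (Ideal.absNorm (J : Ideal (𝓞 K)))‖⁻¹ *
    (|B| * Ideal.absNorm (J : Ideal (𝓞 K))), fun T hT => ?_⟩
  have hT0 : 0 < T := by linarith
  have h1 := hB (scal J T) (scal_one_le J hT)
  replace h1 := h1.trans (scal_err J hT B)
  have h2 := class_sum hJ (fun k => ψ (k : ZMod p)) (fun _ _ => by simp) g
    (fun x => (hnat _).symm) hT0
  rw [h2, norm_mul, norm_mul, Complex.norm_natCast] at h1
  set S := ∑' I : {I : (Ideal (𝓞 K))⁰ // ClassGroup.mk0 I = c},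
        ψ (Ideal.absNorm (I.1 : Ideal (𝓞 K))) *
        (rho (Real.log (Ideal.absNorm (I.1 : Ideal (𝓞 K)) / T)) : ℂ) with hS
  have hψ0 : 0 < ‖ψ (Ideal.absNorm (J : Ideal (𝓞 K)))‖ := norm_pos_iff.mpr hJu
  rw [mul_assoc, ← mul_inv, inv_mul_eq_div, le_div_iff₀ (by positivity), mul_comm]
  exact h1

/-- The weighted sum attached to a function on ideals. -/
noncomputable def wsum (X : (Ideal (𝓞 K))⁰ → ℂ) (T : ℝ) : ℂ :=
  ∑' I : (Ideal (𝓞 K))⁰, X I * (rho (Real.log (Ideal.absNorm (I : Ideal (𝓞 K)) / T)) : ℂ)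

theorem wsum_support (X : (Ideal (𝓞 K))⁰ → ℂ) {T : ℝ} (hT : 0 < T) :
    (Function.support fun I : (Ideal (𝓞 K))⁰ =>
      X I * (rho (Real.log (Ideal.absNorm (I : Ideal (𝓞 K)) / T)) : ℂ)).Finite := by
  refine (Ideal.finite_setOfPred_absNorm_le₀ (S := 𝓞 K) ⌊T⌋₊).subset ?_
  intro I hI
  rw [Set.mem_ofPred_eq]
  by_contra hcon
  rw [not_le, Nat.floor_lt hT.le] at hcon
  apply hI
  beta_reduce
  rw [rho_zero_of_ge (Real.log_nonneg (by rw [le_div_iff₀ hT]; linarith))]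
  simp

theorem wsum_classes (χ : ClassGroup (𝓞 K) → ℂ) (θ : ℕ → ℂ) {T : ℝ} (hT : 0 < T) :
    wsum (fun I : (Ideal (𝓞 K))⁰ => χ (ClassGroup.mk0 I) * θ (Ideal.absNorm (I : Ideal (𝓞 K)))) T =
      ∑ c, χ c * ∑' I : {I : (Ideal (𝓞 K))⁰ // ClassGroup.mk0 I = c},
        θ (Ideal.absNorm (I.1 : Ideal (𝓞 K))) *
        (rho (Real.log (Ideal.absNorm (I.1 : Ideal (𝓞 K)) / T)) : ℂ) := by
  have hsum : Summable (fun I : (Ideal (𝓞 K))⁰ =>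
      (χ (ClassGroup.mk0 I) * θ (Ideal.absNorm (I : Ideal (𝓞 K)))) *
        (rho (Real.log (Ideal.absNorm (I : Ideal (𝓞 K)) / T)) : ℂ)) :=
    summable_of_hasFiniteSupport (wsum_support
      (fun I : (Ideal (𝓞 K))⁰ => χ (ClassGroup.mk0 I) * θ (Ideal.absNorm (I : Ideal (𝓞 K)))) hT)
  rw [wsum, ← (Equiv.sigmaFiberEquiv (ClassGroup.mk0 (R := 𝓞 K))).tsum_eq]
  refine (Summable.tsum_sigma ((Equiv.sigmaFiberEquiv
    (ClassGroup.mk0 (R := 𝓞 K))).summable_iff.mpr hsum)).trans ?_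
  rw [tsum_fintype]
  refine Finset.sum_congr rfl fun c _ => ?_
  rw [← tsum_mul_left]
  refine tsum_congr fun I => ?_
  have : ClassGroup.mk0 ((Equiv.sigmaFiberEquiv (ClassGroup.mk0 (R := 𝓞 K))) ⟨c, I⟩) = c := I.2
  simp only [Function.comp_apply]
  rw [this, mul_assoc]
  rfl

theorem wsum_bound_one (χ : ClassGroup (𝓞 K) →* ℂˣ) (hχ : χ ≠ 1) :
    ∃ B : ℝ, ∀ T : ℝ, 1 ≤ T →
      ‖wsum (fun I : (Ideal (𝓞 K))⁰ => (χ (ClassGroup.mk0 I) : ℂ) * 1) T‖ ≤ B * err K T := by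
  obtain ⟨κ, hκ⟩ := class_asymp_one K
  choose B hB using hκ
  refine ⟨∑ c, ‖(χ c : ℂ)‖ * B c, fun T hT => ?_⟩
  have hT0 : 0 < T := by linarith
  rw [wsum_classes (fun c => (χ c : ℂ)) (fun _ => 1) hT0]
  have h0 : ∑ c, (χ c : ℂ) = 0 := by
    have hne : ∃ d, χ d ≠ 1 := by
      by_contra hcon
      push Not at hcon
      exact hχ (MonoidHom.ext hcon)
    obtain ⟨d, hd⟩ := hne
    have h1 : ∑ c, (χ (d * c) : ℂ) = ∑ c, (χ c : ℂ) :=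
      Function.Bijective.sum_comp (Group.mulLeft_bijective d) (fun c => (χ c : ℂ))
    simp only [map_mul, Units.val_mul, ← Finset.mul_sum] at h1
    have h2 : ((χ d : ℂ) - 1) * ∑ c, (χ c : ℂ) = 0 := by rw [sub_mul, h1]; ring
    refine (mul_eq_zero.mp h2).resolve_left (sub_ne_zero.mpr ?_)
    exact fun h => hd (Units.ext h)
  simp only [one_mul]
  have h3 : ∑ c, (χ c : ℂ) * ∑' I : {I : (Ideal (𝓞 K))⁰ // ClassGroup.mk0 I = c},
        (rho (Real.log (Ideal.absNorm (I.1 : Ideal (𝓞 K)) / T)) : ℂ) =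
      ∑ c, (χ c : ℂ) * (∑' I : {I : (Ideal (𝓞 K))⁰ // ClassGroup.mk0 I = c},
        (rho (Real.log (Ideal.absNorm (I.1 : Ideal (𝓞 K)) / T)) : ℂ) - κ * T) := by
    simp only [mul_sub, Finset.sum_sub_distrib, ← Finset.sum_mul, h0, zero_mul, sub_zero]
  rw [h3]
  refine (norm_sum_le _ _).trans ?_
  rw [Finset.sum_mul]
  refine Finset.sum_le_sum fun c _ => ?_
  rw [norm_mul, mul_assoc]
  exact mul_le_mul_of_nonneg_left (hB c T hT) (norm_nonneg _)

theorem wsum_bound_char (χ : ClassGroup (𝓞 K) →* ℂˣ)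
    (p : ℕ) (hp : p.Prime) (ψ : DirichletCharacter ℂ p) (heven : ψ (-1) = 1)
    (a : ℤ) (ha : IsCoprime a (p : ℤ)) (hψ : ψ a ^ finrank ℚ K ≠ 1) :
    ∃ B : ℝ, ∀ T : ℝ, 1 ≤ T →
      ‖wsum (fun I : (Ideal (𝓞 K))⁰ => (χ (ClassGroup.mk0 I) : ℂ) *
        ψ (Ideal.absNorm (I : Ideal (𝓞 K)))) T‖ ≤ B * err K T := by
  choose B hB using class_asymp_char (K := K) p hp ψ heven a ha hψ
  refine ⟨∑ c, ‖(χ c : ℂ)‖ * B c, fun T hT => ?_⟩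
  have hT0 : 0 < T := by linarith
  rw [wsum_classes (fun c => (χ c : ℂ)) (fun k => ψ (k : ZMod p)) hT0]
  refine (norm_sum_le _ _).trans ?_
  rw [Finset.sum_mul]
  refine Finset.sum_le_sum fun c _ => ?_
  rw [norm_mul, mul_assoc]
  exact mul_le_mul_of_nonneg_left (hB c T hT) (norm_nonneg _)

end asymp

end S19

namespace S19

open MeasureTheory Module NumberField nonZeroDivisors

section mellin

open scoped Classical

variable (K : Type*) [Field K] [NumberField K]

theorem lseries_summable {s : ℝ} (hs : 1 < s) :
    LSeriesSummable (fun n => ((Nat.card {I : Ideal (𝓞 K) // Ideal.absNorm I = n} : ℝ) : ℂ)) s := by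
  refine LSeriesSummable_of_sum_norm_bigO_and_nonneg (r := 1) ?_ (fun _ => Nat.cast_nonneg _)
    zero_le_one (by simpa using hs)
  have h1 := ((Ideal.tendsto_norm_le_div_atTop₀ K).comp
    tendsto_natCast_atTop_atTop).isBigO_one ℝ
  have h2 : (fun n : ℕ => ∑ k ∈ Finset.Icc 1 n,
      (Nat.card {I : Ideal (𝓞 K) // Ideal.absNorm I = k} : ℝ)) =
      fun n : ℕ => (Nat.card {I : (Ideal (𝓞 K))⁰ //
        (Ideal.absNorm (I : Ideal (𝓞 K)) : ℝ) ≤ (n : ℝ)} : ℝ) := by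
    funext n
    simp only [Nat.cast_le, ← Nat.cast_sum]
    congr 1
    symm
    rw [← add_left_inj 1, ← Ideal.card_norm_le_eq_card_norm_le_add_one,
      show Finset.Icc 1 n = Finset.Ioc 0 n from Finset.Icc_succ_left_eq_Ioc _ _,
      show 1 = Nat.card {I : Ideal (𝓞 K) // Ideal.absNorm I = 0} by
        simp [Ideal.absNorm_eq_zero_iff],
      Finset.sum_Ioc_add_eq_sum_Icc (n.zero_le),
      ← Finset.card_preimage_eq_sum_card_image_eq
        (fun k _ => Ideal.finite_setOfPred_absNorm_eq k)]
    simp [Set.coe_eq_subtype]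
  rw [h2]
  have h3 := h1.mul (Asymptotics.isBigO_refl (fun n : ℕ => (n : ℝ) ^ (1 : ℝ)) Filter.atTop)
  refine (h3.congr' ?_ ?_)
  · filter_upwards [Filter.eventually_gt_atTop 0] with n hn
    have : (n : ℝ) ≠ 0 := by positivity
    simp only [Function.comp_apply, Real.rpow_one]
    field_simp
  · filter_upwards with n
    simp

theorem summable_norm {s : ℝ} (hs : 1 < s) :
    Summable (fun I : (Ideal (𝓞 K))⁰ => (Ideal.absNorm (I : Ideal (𝓞 K)) : ℝ) ^ (-s)) := by
  let f : (Ideal (𝓞 K))⁰ → ℕ := fun I => Ideal.absNorm (I : Ideal (𝓞 K))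
  rw [← (Equiv.sigmaFiberEquiv f).summable_iff]
  have hfin : ∀ k, Finite {I : (Ideal (𝓞 K))⁰ // f I = k} := fun k =>
    ((Ideal.finite_setOfPred_absNorm_le₀ (S := 𝓞 K) k).subset (fun I (hI : f I = k) => by
      rw [Set.mem_ofPred_eq]; exact hI.le)).to_subtype
  have hval : ∀ k, ∀ I : {I : (Ideal (𝓞 K))⁰ // f I = k},
      ((fun I : (Ideal (𝓞 K))⁰ => (Ideal.absNorm (I : Ideal (𝓞 K)) : ℝ) ^ (-s)) ∘
        (Equiv.sigmaFiberEquiv f)) ⟨k, I⟩ = (k : ℝ) ^ (-s) := by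
    intro k I
    have : f ((Equiv.sigmaFiberEquiv f) ⟨k, I⟩) = k := I.2
    simp only [Function.comp_apply]
    change ((f ((Equiv.sigmaFiberEquiv f) ⟨k, I⟩) : ℕ) : ℝ) ^ (-s) = _
    rw [this]
  rw [summable_sigma_of_nonneg]
  · refine ⟨fun k => ?_, ?_⟩
    · have := hfin k
      exact Summable.of_finite
    · refine Summable.of_nonneg_of_le (fun k => tsum_nonneg fun I => ?_) (fun k => ?_)
        (lseries_summable K hs).norm
      · rw [hval]; positivity
      · have := hfin k
        have := Fintype.ofFinite {I : (Ideal (𝓞 K))⁰ // f I = k}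
        rw [tsum_congr (hval k), tsum_fintype, Finset.sum_const, Finset.card_univ,
          nsmul_eq_mul, ← Nat.card_eq_fintype_card]
        rcases Nat.eq_zero_or_pos k with rfl | hk
        · have : IsEmpty {I : (Ideal (𝓞 K))⁰ // f I = 0} :=
            ⟨fun I => (absNorm_pos I.1).ne' I.2⟩
          simp
        · rw [LSeries.norm_term_eq, if_neg hk.ne', Complex.ofReal_re, Real.rpow_neg (by positivity),
            ← div_eq_mul_inv, Complex.norm_real, Real.norm_natCast]
          gcongr
          have : Finite {I : Ideal (𝓞 K) // Ideal.absNorm I = k} :=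
            (Ideal.finite_setOfPred_absNorm_eq k).to_subtype
          refine Nat.card_le_card_of_injective
            (fun I : {I : (Ideal (𝓞 K))⁰ // f I = k} => (⟨I.1.1, I.2⟩ :
              {I : Ideal (𝓞 K) // Ideal.absNorm I = k})) ?_
          intro I J hIJ
          simp only [Subtype.mk.injEq] at hIJ
          exact Subtype.ext (Subtype.ext hIJ)
  · rintro ⟨k, I⟩
    rw [hval]; positivity

theorem countable_ideals : Countable (Ideal (𝓞 K))⁰ := by
  have h := (summable_norm K one_lt_two).countable_support
  rw [← Set.countable_univ_iff]
  refine h.mono fun I _ => ?_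
  have : (0 : ℝ) < Ideal.absNorm (I : Ideal (𝓞 K)) := by exact_mod_cast absNorm_pos I
  rw [Function.mem_support]
  positivity

theorem rho_continuous : Continuous rho := (rho_contDiff (n := 0)).continuous

theorem rho_compact : HasCompactSupport rho := by
  refine HasCompactSupport.intro (K := Set.Icc (-2) 0) isCompact_Icc fun x hx => ?_
  rw [Set.mem_Icc, not_and_or, not_le, not_le] at hx
  rcases hx with hx | hx
  · exact rho_zero_of_le hx.le
  · exact rho_zero_of_ge hx.le

/-- Laplace transform of `rho`. -/
noncomputable def cRho (s : ℝ) : ℝ := ∫ u, rho u * Real.exp (s * u)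

theorem rho_exp_integrable (s : ℝ) : Integrable (fun u => rho u * Real.exp (s * u)) :=
  (rho_continuous.mul (by fun_prop)).integrable_of_hasCompactSupport
    (rho_compact.mul_right)

theorem cRho_lower : ∃ c0 : ℝ, 0 < c0 ∧ ∀ s ∈ Set.Icc (1 : ℝ) 2, c0 ≤ cRho s := by
  have hi : Integrable rho := rho_continuous.integrable_of_hasCompactSupport rho_compact
  have hpos : 0 < ∫ u, rho u :=
    rho_continuous.integral_pos_of_hasCompactSupport_nonneg_nonzero rho_compact
      (fun u => rho_nonneg u) (x := -1) (by rw [rho]; norm_num [tau_at_zero])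
  refine ⟨(∫ u, rho u) * Real.exp (-4), by positivity, fun s hs => ?_⟩
  rw [← integral_mul_const, cRho]
  refine integral_mono (hi.mul_const _) (rho_exp_integrable s) fun u => ?_
  rcases le_or_gt u (-2) with h | h
  · simp [rho_zero_of_le h]
  · refine mul_le_mul_of_nonneg_left (Real.exp_le_exp.mpr ?_) (rho_nonneg u)
    nlinarith [hs.1, hs.2]

theorem integral_shift (s : ℝ) (ℓ : ℝ) :
    ∫ v, rho (ℓ - v) * Real.exp (-s * v) = Real.exp (-s * ℓ) * cRho s := by
  rw [cRho, ← integral_const_mul]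
  rw [← integral_sub_left_eq_self (fun v => rho (ℓ - v) * Real.exp (-s * v)) volume ℓ]
  refine integral_congr_ae (Filter.Eventually.of_forall fun v => ?_)
  beta_reduce
  rw [show ℓ - (ℓ - v) = v by ring, show -s * (ℓ - v) = -s * ℓ + s * v by ring, Real.exp_add]
  ring

theorem integrable_shift (s : ℝ) (ℓ : ℝ) :
    Integrable (fun v => rho (ℓ - v) * Real.exp (-s * v)) := by
  rw [← integrable_comp_sub_left (fun v => rho (ℓ - v) * Real.exp (-s * v)) ℓ]
  have := (rho_exp_integrable s).const_mul (Real.exp (-s * ℓ))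
  refine this.congr (Filter.Eventually.of_forall fun v => ?_)
  beta_reduce
  rw [show ℓ - (ℓ - v) = v by ring, show -s * (ℓ - v) = -s * ℓ + s * v by ring, Real.exp_add]
  ring

variable {K}

theorem wsum_zero (X : (Ideal (𝓞 K))⁰ → ℂ) {T : ℝ} (hT0 : 0 < T) (hT : T ≤ 1) : wsum X T = 0 := by
  rw [wsum]
  convert tsum_zero with I
  have h1 : (1 : ℝ) ≤ Ideal.absNorm (I : Ideal (𝓞 K)) := by exact_mod_cast absNorm_pos I
  rw [rho_zero_of_ge (Real.log_nonneg (by rw [le_div_iff₀ hT0]; linarith))]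
  simp

theorem dirichlet_bounded (X : (Ideal (𝓞 K))⁰ → ℂ) (hX : ∀ I, ‖X I‖ ≤ 1)
    (hB : ∃ B : ℝ, ∀ T : ℝ, 1 ≤ T → ‖wsum X T‖ ≤ B * err K T) :
    ∃ C : ℝ, ∀ s ∈ Set.Ioc (1 : ℝ) 2, ‖∑' I : (Ideal (𝓞 K))⁰,
      X I * (((Ideal.absNorm (I : Ideal (𝓞 K)) : ℝ) ^ (-s) : ℝ) : ℂ)‖ ≤ C := by
  obtain ⟨B, hB⟩ := hB
  obtain ⟨c0, hc0, hc⟩ := cRho_lower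
  have hn : (0 : ℝ) < (finrank ℚ K : ℝ)⁻¹ := by
    have := finrank_pos (R := ℚ) (M := K)
    positivity
  set δ := (finrank ℚ K : ℝ)⁻¹ with hδ
  refine ⟨(|B| * ∫ v in Set.Ioi (0 : ℝ), Real.exp (-δ * v)) / c0, fun s hs => ?_⟩
  have hcs : c0 ≤ cRho s := hc s ⟨hs.1.le, hs.2⟩
  have hcpos : 0 < cRho s := hc0.trans_le hcs
  let F : (Ideal (𝓞 K))⁰ → ℝ → ℂ := fun I v =>
    X I * ((rho (Real.log (Ideal.absNorm (I : Ideal (𝓞 K))) - v) * Real.exp (-s * v) : ℝ) : ℂ)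
  have hpow : ∀ I : (Ideal (𝓞 K))⁰, Real.exp (-s * Real.log (Ideal.absNorm (I : Ideal (𝓞 K)))) =
      (Ideal.absNorm (I : Ideal (𝓞 K)) : ℝ) ^ (-s) := by
    intro I
    rw [Real.rpow_def_of_pos (by exact_mod_cast absNorm_pos I), mul_comm]
  have hFi : ∀ I, Integrable (F I) := fun I => (integrable_shift s _).ofReal.const_mul _
  have hFint : ∀ I, ∫ v, F I v =
      X I * (((Ideal.absNorm (I : Ideal (𝓞 K)) : ℝ) ^ (-s) : ℝ) : ℂ) * (cRho s : ℂ) := by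
    intro I
    simp only [F]
    rw [integral_const_mul, integral_complex_ofReal, integral_shift, hpow]
    push_cast
    ring
  have hFnorm : ∀ I v, ‖F I v‖ = ‖X I‖ *
      (rho (Real.log (Ideal.absNorm (I : Ideal (𝓞 K))) - v) * Real.exp (-s * v)) := by
    intro I v
    simp only [F]
    rw [norm_mul, Complex.norm_real, Real.norm_eq_abs, abs_of_nonneg]
    exact mul_nonneg (rho_nonneg _) (Real.exp_pos _).le
  have hsumm : Summable fun I => ∫ v, ‖F I v‖ := by
    simp only [hFnorm, integral_const_mul, integral_shift, hpow]
    refine Summable.of_nonneg_of_le (fun I => by positivity) (fun I => ?_)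
      ((summable_norm K hs.1).mul_right (cRho s))
    exact mul_le_of_le_one_left (by positivity) (hX I)
  have := countable_ideals K
  have key := (hasSum_integral_of_summable_integral_norm hFi hsumm).tsum_eq
  simp only [hFint] at key
  rw [tsum_mul_right] at key
  have hF : ∀ v, ∑' I, F I v = wsum X (Real.exp v) * (Real.exp (-s * v) : ℂ) := by
    intro v
    rw [wsum, ← tsum_mul_right]
    refine tsum_congr fun I => ?_
    simp only [F]
    rw [Real.log_div (by exact_mod_cast (absNorm_pos I).ne') (Real.exp_pos v).ne', Real.log_exp]
    push_cast
    ring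
  have hbound : ‖∫ v, ∑' I, F I v‖ ≤ ∫ v, (Set.Ioi (0 : ℝ)).indicator
      (fun v => |B| * Real.exp (-δ * v)) v := by
    refine norm_integral_le_of_norm_le ?_ (Filter.Eventually.of_forall fun v => ?_)
    · rw [integrable_indicator_iff measurableSet_Ioi]
      exact (integrableOn_exp_mul_Ioi (neg_lt_zero.mpr hn) 0).const_mul _
    · rw [hF]
      rcases le_or_gt v 0 with hv | hv
      · rw [wsum_zero X (Real.exp_pos v) (Real.exp_le_one_iff.mpr hv), zero_mul, norm_zero,
          Set.indicator_of_notMem (by simpa using hv)]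
      · rw [Set.indicator_of_mem (by simpa using hv), norm_mul,
          Complex.norm_real, Real.norm_eq_abs, abs_of_pos (Real.exp_pos _)]
        have h1 := hB (Real.exp v) (Real.one_le_exp hv.le)
        rw [err, ← hδ, ← Real.exp_mul, ← Real.exp_add] at h1
        calc ‖wsum X (Real.exp v)‖ * Real.exp (-s * v)
            ≤ (B * Real.exp (v + v * -δ)) * Real.exp (-s * v) := by gcongr
          _ ≤ (|B| * Real.exp (v + v * -δ)) * Real.exp (-s * v) := by
              gcongr; exact le_abs_self B
          _ = |B| * Real.exp ((v + v * -δ) + -s * v) := by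
              rw [Real.exp_add (v + v * -δ), mul_assoc]
          _ ≤ |B| * Real.exp (-δ * v) := by
              refine mul_le_mul_of_nonneg_left (Real.exp_le_exp.mpr ?_) (abs_nonneg B)
              nlinarith [hs.1]
  rw [integral_indicator measurableSet_Ioi, integral_const_mul, ← key, norm_mul,
    Complex.norm_real, Real.norm_eq_abs, abs_of_pos hcpos] at hbound
  rw [le_div_iff₀ hc0]
  exact (mul_le_mul_of_nonneg_left hcs (norm_nonneg _)).trans hbound

end mellin

end S19

namespace S19

open Module NumberField nonZeroDivisors

section euler

open scoped Classical

theorem norm_one_sub_le (w : ℂ) : ‖1 - w‖ ≤ Real.exp (-w.re + ‖w‖ ^ 2 / 2) := by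
  have h1 : ‖1 - w‖ ^ 2 = 1 + (2 * (-w.re + ‖w‖ ^ 2 / 2)) := by
    rw [← Complex.normSq_eq_norm_sq, ← Complex.normSq_eq_norm_sq, Complex.normSq_apply,
      Complex.normSq_apply]
    simp only [Complex.sub_re, Complex.one_re, Complex.sub_im, Complex.one_im]
    ring
  have h2 : ‖1 - w‖ ^ 2 ≤ Real.exp (-w.re + ‖w‖ ^ 2 / 2) ^ 2 := by
    rw [h1, ← Real.exp_nat_mul]
    have := Real.add_one_le_exp (2 * (-w.re + ‖w‖ ^ 2 / 2))
    push_cast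
    linarith
  exact le_of_sq_le_sq h2 (Real.exp_pos _).le

variable {K : Type*} [Field K] [NumberField K]

variable (K) in
/-- Nonzero primes. -/
abbrev PP : Type _ := {q : (Ideal (𝓞 K))⁰ // (q : Ideal (𝓞 K)).IsPrime}

/-- Coprimality to a finite set of primes. -/
def Cop (S : Finset (PP K)) (I : (Ideal (𝓞 K))⁰) : Prop :=
  ∀ q ∈ S, ¬ ((q.1 : Ideal (𝓞 K)) ∣ (I : Ideal (𝓞 K)))

theorem cop_insert (S : Finset (PP K)) (q : PP K) (I : (Ideal (𝓞 K))⁰) :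
    Cop (insert q S) I ↔ ¬ ((q.1 : Ideal (𝓞 K)) ∣ (I : Ideal (𝓞 K))) ∧ Cop S I := by
  simp [Cop]

theorem PP.prime (q : PP K) : Prime (q.1 : Ideal (𝓞 K)) :=
  Ideal.prime_of_isPrime (nonZeroDivisors.coe_ne_zero q.1) q.2

theorem cop_mul (S : Finset (PP K)) (q : PP K) (hq : q ∉ S) (I : (Ideal (𝓞 K))⁰) :
    Cop S (q.1 * I) ↔ Cop S I := by
  refine forall₂_congr fun r hr => not_congr ?_
  rw [Submonoid.coe_mul, r.prime.dvd_mul, or_iff_right]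
  intro hdvd
  have hne : r ≠ q := fun h => hq (h ▸ hr)
  apply hne
  apply Subtype.ext
  apply Subtype.ext
  exact associated_iff_eq.mp (r.prime.associated_of_dvd q.prime hdvd)

theorem euler_partial (Y : (Ideal (𝓞 K))⁰ →* ℂ) (hY : Summable fun I => ‖Y I‖)
    (S : Finset (PP K)) :
    (∑' I, Y I) * ∏ q ∈ S, (1 - Y q.1) = ∑' I, if Cop S I then Y I else 0 := by
  induction S using Finset.induction_on with
  | empty => simp [Cop]
  | insert q S hq ih =>
    rw [Finset.prod_insert hq, mul_left_comm, ih, sub_mul, one_mul, ← tsum_mul_left]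
    have hs1 : ∀ (P : (Ideal (𝓞 K))⁰ → Prop) [DecidablePred P], Summable fun I => if P I then Y I else 0 := by
      intro P _
      refine Summable.of_norm_bounded hY fun I => ?_
      split_ifs <;> simp
    have hinj : Function.Injective (fun I : (Ideal (𝓞 K))⁰ => q.1 * I) := mul_right_injective q.1
    have h2 : ∑' I, Y q.1 * (if Cop S I then Y I else 0) =
        ∑' J : (Ideal (𝓞 K))⁰, if ((q.1 : Ideal (𝓞 K)) ∣ (J : Ideal (𝓞 K))) ∧ Cop S J
          then Y J else 0 := by
      rw [← hinj.tsum_eq (f := fun J : (Ideal (𝓞 K))⁰ =>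
        if ((q.1 : Ideal (𝓞 K)) ∣ (J : Ideal (𝓞 K))) ∧ Cop S J then Y J else 0)]
      · refine tsum_congr fun I => ?_
        rw [cop_mul S q hq, map_mul, mul_ite, mul_zero, Submonoid.coe_mul]
        simp
      · intro J hJ
        rw [Function.mem_support] at hJ
        have hd : ((q.1 : Ideal (𝓞 K)) ∣ (J : Ideal (𝓞 K))) := by
          by_contra hcon
          exact hJ (if_neg fun h => hcon h.1)
        obtain ⟨I, hI⟩ := hd
        have hI0 : I ≠ 0 := by
          rintro rfl
          exact nonZeroDivisors.coe_ne_zero J (by rw [hI, mul_zero])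
        exact ⟨⟨I, mem_nonZeroDivisors_of_ne_zero hI0⟩, Subtype.ext hI.symm⟩
    rw [h2, ← Summable.tsum_sub (hs1 _) (hs1 _)]
    refine tsum_congr fun I => ?_
    rw [cop_insert]
    by_cases h1 : (q.1 : Ideal (𝓞 K)) ∣ (I : Ideal (𝓞 K)) <;> by_cases h2 : Cop S I <;>
      simp [h1, h2]

variable (K) in
/-- The norm power as a hom. -/
noncomputable def npow (s : ℝ) : (Ideal (𝓞 K))⁰ →* ℂ where
  toFun I := (((Ideal.absNorm (I : Ideal (𝓞 K)) : ℝ) ^ (-s) : ℝ) : ℂ)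
  map_one' := by simp
  map_mul' I J := by
    rw [Submonoid.coe_mul, map_mul, Nat.cast_mul, Real.mul_rpow (by positivity) (by positivity)]
    push_cast
    rfl

theorem npow_norm (s : ℝ) (I : (Ideal (𝓞 K))⁰) :
    ‖npow K s I‖ = (Ideal.absNorm (I : Ideal (𝓞 K)) : ℝ) ^ (-s) := by
  change ‖(((Ideal.absNorm (I : Ideal (𝓞 K)) : ℝ) ^ (-s) : ℝ) : ℂ)‖ = _
  rw [Complex.norm_real, Real.norm_eq_abs, abs_of_nonneg (by positivity)]

theorem euler_lower {s : ℝ} (hs : 1 < s) (S0 : Finset (PP K)) : ∃ S : Finset (PP K), S0 ⊆ S ∧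
    ∀ X : (Ideal (𝓞 K))⁰ →* ℂ, (∀ I, ‖X I‖ ≤ 1) →
      1 / 2 ≤ ‖∑' I, X I * npow K s I‖ * ∏ q ∈ S, ‖1 - X q.1 * npow K s q.1‖ := by
  have hsum := summable_norm K hs
  have h0 := hsum.tendsto_cofinite_zero
  have := tendsto_tsum_compl_atTop_zero
    (fun I : (Ideal (𝓞 K))⁰ => (Ideal.absNorm (I : Ideal (𝓞 K)) : ℝ) ^ (-s))
  obtain ⟨F, hF⟩ := (this.eventually (gt_mem_nhds (show (0 : ℝ) < 1 / 2 by norm_num))).exists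
  let n := F.sup (fun I => Ideal.absNorm (I : Ideal (𝓞 K)))
  have hfin : {q : PP K | Ideal.absNorm (q.1 : Ideal (𝓞 K)) ≤ n}.Finite :=
    Set.Finite.preimage (f := fun q : PP K => q.1) Subtype.val_injective.injOn
      (Ideal.finite_setOfPred_absNorm_le₀ (S := 𝓞 K) n)
  refine ⟨S0 ∪ hfin.toFinset, Finset.subset_union_left, fun X hX => ?_⟩
  set S := S0 ∪ hfin.toFinset
  let Y : (Ideal (𝓞 K))⁰ →* ℂ := X * npow K s
  have hYn : ∀ I, ‖Y I‖ ≤ (Ideal.absNorm (I : Ideal (𝓞 K)) : ℝ) ^ (-s) := by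
    intro I
    simp only [Y, MonoidHom.mul_apply]
    rw [norm_mul, npow_norm]
    exact mul_le_of_le_one_left (by positivity) (hX I)
  have hYs : Summable fun I => ‖Y I‖ :=
    Summable.of_nonneg_of_le (fun _ => norm_nonneg _) hYn hsum
  have h1 := euler_partial Y hYs S
  have h2 : ‖(∑' I, Y I) * ∏ q ∈ S, (1 - Y q.1)‖ =
      ‖∑' I, X I * npow K s I‖ * ∏ q ∈ S, ‖1 - X q.1 * npow K s q.1‖ := by
    rw [norm_mul, norm_prod]
    simp only [Y, MonoidHom.mul_apply]
  rw [← h2, h1]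
  -- the ideals of `F` coprime to `S` are trivial
  have hFcop : ∀ I ∈ F, I ≠ 1 → ¬ Cop S I := by
    intro I hI hI1 hcop
    have hIne : (I : Ideal (𝓞 K)) ≠ ⊤ := fun h => hI1 (Subtype.ext (by rw [h, Submonoid.coe_one, Ideal.one_eq_top]))
    obtain ⟨m, hm, hle⟩ := Ideal.exists_le_maximal _ hIne
    have hdvd : m ∣ (I : Ideal (𝓞 K)) := Ideal.dvd_iff_le.mpr hle
    have hm0 : m ≠ 0 := by
      rintro rfl
      exact nonZeroDivisors.coe_ne_zero I (zero_dvd_iff.mp hdvd)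
    refine hcop ⟨⟨m, mem_nonZeroDivisors_of_ne_zero hm0⟩, hm.isPrime⟩ ?_ hdvd
    refine Finset.mem_union_right _ ?_
    rw [Set.Finite.mem_toFinset, Set.mem_ofPred_eq]
    refine (Nat.le_of_dvd (absNorm_pos I) (map_dvd Ideal.absNorm hdvd)).trans ?_
    exact Finset.le_sup (f := fun I : (Ideal (𝓞 K))⁰ => Ideal.absNorm (I : Ideal (𝓞 K))) hI
  have hcop1 : Cop S 1 := by
    intro q _ hq
    exact q.prime.not_unit (isUnit_of_dvd_one hq)
  let Z : (Ideal (𝓞 K))⁰ → ℂ := fun I => if Cop S I then Y I else 0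
  have hZn : ∀ I, ‖Z I‖ ≤ (Ideal.absNorm (I : Ideal (𝓞 K)) : ℝ) ^ (-s) := by
    intro I
    simp only [Z]
    split_ifs
    · exact hYn I
    · rw [norm_zero]; positivity
  have hZs : Summable Z := Summable.of_norm_bounded hsum hZn
  have hZ1 : Z 1 = 1 := by simp [Z, hcop1]
  have h1F : (1 : (Ideal (𝓞 K))⁰) ∈ F := by
    by_contra hcon
    have h3 : (1 : ℝ) ≤ ∑' a : { x // x ∉ F }, (Ideal.absNorm (a.1 : Ideal (𝓞 K)) : ℝ) ^ (-s) := by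
      have h5 : (1 : ℝ) = (Ideal.absNorm ((1 : (Ideal (𝓞 K))⁰) : Ideal (𝓞 K)) : ℝ) ^ (-s) := by
        simp
      rw [h5]
      exact (hsum.subtype {x | x ∉ F}).le_tsum ⟨1, hcon⟩ (fun _ _ => by
        simp only [Function.comp_apply]; positivity)
    linarith
  have hsplit : ∑' I, Z I = 1 + ∑' a : { x // x ∉ F }, Z a := by
    rw [← hZs.sum_add_tsum_subtype_compl F, Finset.sum_eq_single_of_mem 1 h1F, hZ1]
    intro I hI hI1
    simp [Z, hFcop I hI hI1]
  have htail : ‖∑' a : { x // x ∉ F }, Z a‖ ≤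
      ∑' a : { x // x ∉ F }, (Ideal.absNorm (a.1 : Ideal (𝓞 K)) : ℝ) ^ (-s) :=
    tsum_of_norm_bounded (hsum.subtype {x | x ∉ F}).hasSum fun a => hZn a
  change 1 / 2 ≤ ‖∑' I, Z I‖
  rw [hsplit]
  have h4 := norm_sub_norm_le (1 : ℂ) (-∑' a : { x // x ∉ F }, Z a)
  rw [norm_neg, norm_one, sub_neg_eq_add] at h4
  linarith

theorem euler_main {ι : Type*} [Fintype ι] (X : ι → ((Ideal (𝓞 K))⁰ →* ℂ))
    (hX : ∀ i I, ‖X i I‖ ≤ 1)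
    (hC : ∀ i, ∃ C : ℝ, ∀ s ∈ Set.Ioc (1 : ℝ) 2, ‖∑' I, X i I * npow K s I‖ ≤ C)
    (hnn : ∀ q : PP K, 0 ≤ ∑ i, (X i q.1).re)
    (G : Set (PP K)) (hG : ∀ q ∈ G, 1 ≤ ∑ i, (X i q.1).re) :
    Summable fun q : G => (Ideal.absNorm (q.1.1 : Ideal (𝓞 K)) : ℝ)⁻¹ := by
  choose C hC using hC
  have hsum2 := summable_norm K one_lt_two
  let E : ℝ := ∑' I : (Ideal (𝓞 K))⁰, (Ideal.absNorm (I : Ideal (𝓞 K)) : ℝ) ^ (-2 : ℝ)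
  -- uniform bound
  have key : ∀ s ∈ Set.Ioc (1 : ℝ) 2, ∀ S0 : Finset G,
      ∑ q ∈ S0, (Ideal.absNorm (q.1.1 : Ideal (𝓞 K)) : ℝ) ^ (-s) ≤
        Real.log (∏ i, (2 * C i)) + Fintype.card ι * E / 2 := by
    intro s hs S0
    obtain ⟨S, hS0, hS⟩ := euler_lower hs.1 (S0.map (Function.Embedding.subtype _))
    let w : ι → PP K → ℂ := fun i q => X i q.1 * npow K s q.1
    have hw2 : ∀ i q, ‖w i q‖ ^ 2 ≤ (Ideal.absNorm (q.1 : Ideal (𝓞 K)) : ℝ) ^ (-2 : ℝ) := by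
      intro i q
      have hN : (1 : ℝ) ≤ Ideal.absNorm (q.1 : Ideal (𝓞 K)) := by exact_mod_cast absNorm_pos q.1
      have h1 : ‖w i q‖ ≤ (Ideal.absNorm (q.1 : Ideal (𝓞 K)) : ℝ) ^ (-1 : ℝ) := by
        simp only [w]
        rw [norm_mul, npow_norm]
        refine (mul_le_of_le_one_left (by positivity) (hX i q.1)).trans ?_
        exact Real.rpow_le_rpow_of_exponent_le hN (by linarith [hs.1])
      calc ‖w i q‖ ^ 2 ≤ ((Ideal.absNorm (q.1 : Ideal (𝓞 K)) : ℝ) ^ (-1 : ℝ)) ^ 2 := by gcongr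
        _ = _ := by rw [← Real.rpow_mul_natCast (by positivity)]; norm_num
    have hwre : ∀ q, ∑ i, (w i q).re =
        (Ideal.absNorm (q.1 : Ideal (𝓞 K)) : ℝ) ^ (-s) * ∑ i, (X i q.1).re := by
      intro q
      rw [Finset.mul_sum]
      refine Finset.sum_congr rfl fun i _ => ?_
      change (X i q.1 * (((Ideal.absNorm (q.1 : Ideal (𝓞 K)) : ℝ) ^ (-s) : ℝ) : ℂ)).re = _
      rw [Complex.re_mul_ofReal, mul_comm]
    have h1 : ∀ i, 1 ≤ (2 * C i) * ∏ q ∈ S, ‖1 - w i q‖ := by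
      intro i
      have h2 := hS (X i) (hX i)
      have h3 : 0 ≤ ∏ q ∈ S, ‖1 - w i q‖ := Finset.prod_nonneg fun _ _ => norm_nonneg _
      have h4 := mul_le_mul_of_nonneg_right (hC i s hs) h3
      have h5 := h2.trans h4
      linarith
    have hCpos : ∀ i, 0 < C i := by
      intro i
      have h3 : 0 ≤ ∏ q ∈ S, ‖1 - w i q‖ := Finset.prod_nonneg fun _ _ => norm_nonneg _
      by_contra hcon
      push Not at hcon
      have := h1 i
      nlinarith
    have hCprod : 0 < ∏ i, (2 * C i) := Finset.prod_pos fun i _ => by linarith [hCpos i]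
    have h2 : (1 : ℝ) ≤ (∏ i, (2 * C i)) * Real.exp (∑ i, ∑ q ∈ S, (-(w i q).re + ‖w i q‖ ^ 2 / 2)) := by
      rw [Real.exp_sum, ← Finset.prod_mul_distrib, ← Finset.prod_const_one (s := (Finset.univ : Finset ι))]
      refine Finset.prod_le_prod (fun _ _ => zero_le_one) fun i _ => (h1 i).trans ?_
      rw [Real.exp_sum]
      refine mul_le_mul_of_nonneg_left ?_ (by linarith [hCpos i])
      exact Finset.prod_le_prod (fun _ _ => norm_nonneg _) fun q _ => norm_one_sub_le _
    have h3 := Real.log_le_log one_pos h2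
    rw [Real.log_one, Real.log_mul hCprod.ne' (Real.exp_pos _).ne', Real.log_exp,
      Finset.sum_comm] at h3
    have h4 : ∑ q ∈ S, ∑ i, (-(w i q).re + ‖w i q‖ ^ 2 / 2) ≤
        -(∑ q ∈ S, ∑ i, (w i q).re) + Fintype.card ι * E / 2 := by
      simp only [Finset.sum_add_distrib, Finset.sum_neg_distrib]
      gcongr
      have h5 : ∑ q ∈ S, (Ideal.absNorm (q.1 : Ideal (𝓞 K)) : ℝ) ^ (-2 : ℝ) ≤ E := by
        have := hsum2.sum_le_tsum (S.map (Function.Embedding.subtype _))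
          (fun _ _ => by positivity)
        rw [Finset.sum_map] at this
        exact this
      calc ∑ q ∈ S, ∑ i, ‖w i q‖ ^ 2 / 2
          ≤ ∑ q ∈ S, ∑ i : ι, (Ideal.absNorm (q.1 : Ideal (𝓞 K)) : ℝ) ^ (-2 : ℝ) / 2 := by
            gcongr with q _ i _
            exact hw2 i q
        _ = Fintype.card ι * (∑ q ∈ S, (Ideal.absNorm (q.1 : Ideal (𝓞 K)) : ℝ) ^ (-2 : ℝ)) / 2 := by
            simp only [Finset.sum_const, Finset.card_univ, nsmul_eq_mul]
            rw [Finset.mul_sum, Finset.sum_div]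
            refine Finset.sum_congr rfl fun q _ => by ring
        _ ≤ _ := by gcongr
    have h6 : ∑ q ∈ S0, (Ideal.absNorm (q.1.1 : Ideal (𝓞 K)) : ℝ) ^ (-s) ≤
        ∑ q ∈ S, ∑ i, (w i q).re := by
      calc ∑ q ∈ S0, (Ideal.absNorm (q.1.1 : Ideal (𝓞 K)) : ℝ) ^ (-s)
          ≤ ∑ q ∈ S0, ∑ i, (w i q.1).re := by
            refine Finset.sum_le_sum fun q _ => ?_
            rw [hwre]
            exact le_mul_of_one_le_right (by positivity) (hG q.1 q.2)
        _ = ∑ q ∈ S0.map (Function.Embedding.subtype _), ∑ i, (w i q).re := by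
            rw [Finset.sum_map]; rfl
        _ ≤ _ := by
            refine Finset.sum_le_sum_of_subset_of_nonneg hS0 fun q _ _ => ?_
            rw [hwre]
            exact mul_nonneg (by positivity) (hnn q)
    linarith
  refine summable_of_sum_le (c := Real.log (∏ i, (2 * C i)) + Fintype.card ι * E / 2)
    (fun _ => by positivity) fun S0 => ?_
  have hlim : Filter.Tendsto (fun s : ℝ => ∑ q ∈ S0,
      (Ideal.absNorm (q.1.1 : Ideal (𝓞 K)) : ℝ) ^ (-s)) (nhdsWithin 1 (Set.Ioi 1))
      (nhds (∑ q ∈ S0, (Ideal.absNorm (q.1.1 : Ideal (𝓞 K)) : ℝ) ^ (-1 : ℝ))) := by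
    refine Filter.Tendsto.mono_left ?_ nhdsWithin_le_nhds
    refine tendsto_finsetSum _ fun q _ => ?_
    have hN : (0 : ℝ) < Ideal.absNorm (q.1.1 : Ideal (𝓞 K)) := by exact_mod_cast absNorm_pos q.1.1
    exact (Real.continuous_const_rpow hN.ne').continuousAt.tendsto.comp
      (continuous_neg.tendsto 1)
  simp only [← Real.rpow_neg_one]
  refine le_of_tendsto hlim ?_
  filter_upwards [Ioc_mem_nhdsGT (show (1 : ℝ) < 2 by norm_num)] with s hs
  exact key s hs S0

end euler

end S19

namespace S19

open Module NumberField nonZeroDivisors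

section contra

open scoped Classical

variable {M : Type*} [Field M] [NumberField M]

theorem chi_norm (χ : ClassGroup (𝓞 M) →* ℂˣ) (c : ClassGroup (𝓞 M)) : ‖(χ c : ℂ)‖ = 1 := by
  have h1 : (χ c : ℂ) ^ Fintype.card (ClassGroup (𝓞 M)) = 1 := by
    rw [← Units.val_pow_eq_pow_val, ← map_pow, pow_card_eq_one, map_one, Units.val_one]
  exact Complex.norm_eq_one_of_pow_eq_one h1 Fintype.card_ne_zero

/-- Twisted character on ideals. -/
noncomputable def chiHom (χ : ClassGroup (𝓞 M) →* ℂˣ) : (Ideal (𝓞 M))⁰ →* ℂ :=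
  (Units.coeHom ℂ).comp (χ.comp ClassGroup.mk0)

/-- Norm character on ideals. -/
noncomputable def psiHom {p : ℕ} (ψ : DirichletCharacter ℂ p) : (Ideal (𝓞 M))⁰ →* ℂ where
  toFun I := ψ ((Ideal.absNorm (I : Ideal (𝓞 M)) : ℕ) : ZMod p)
  map_one' := by simp
  map_mul' I J := by simp

theorem char_contra (p : ℕ) (hp : p.Prime) (hp2 : p ≠ 2) (h : ℕ) (hh : h.Prime) (hh2 : h ≠ 2)
    (hn : Nat.Coprime h (finrank ℚ M)) (b m : ℕ) (hbm : p - 1 = h ^ b * m)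
    (χ : ClassGroup (𝓞 M) →* ℂˣ) (hχ : χ ≠ 1)
    (hχ1 : ∀ q : PP M, ((Ideal.absNorm (q.1 : Ideal (𝓞 M)) : ℕ) : ZMod p) = 0 ∨
      ((Ideal.absNorm (q.1 : Ideal (𝓞 M)) : ℕ) : ZMod p) ^ m = 1 → χ (ClassGroup.mk0 q.1) = 1)
    (hdiv : ¬ Summable fun q : {q : PP M | ((Ideal.absNorm (q.1 : Ideal (𝓞 M)) : ℕ) : ZMod p) ^ m = 1} =>
      (Ideal.absNorm (q.1.1 : Ideal (𝓞 M)) : ℝ)⁻¹) : False := by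
  have : Fact p.Prime := ⟨hp⟩
  have hp1 : 0 < p - 1 := by have := hp.two_le; omega
  have hm0 : m ≠ 0 := by rintro rfl; omega
  have hm2 : Even m := by
    have h1 : Even (p - 1) := hp.even_sub_one hp2
    rw [hbm, Nat.even_mul] at h1
    refine h1.resolve_left ?_
    rw [Nat.not_even_iff_odd]
    exact (hh.odd_of_ne_two hh2).pow
  let X : DirichletCharacter ℂ p → ((Ideal (𝓞 M))⁰ →* ℂ) := fun ω =>
    chiHom χ * (if ω ^ m = 1 then 1 else psiHom (ω ^ m))
  have hX : ∀ ω I, ‖X ω I‖ ≤ 1 := by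
    intro ω I
    simp only [X, MonoidHom.mul_apply]
    rw [norm_mul]
    have h1 : ‖chiHom χ I‖ = 1 := chi_norm χ _
    rw [h1, one_mul]
    split_ifs
    · simp
    · exact DirichletCharacter.norm_le_one _ _
  have hsumval : ∀ q : PP M, ((Ideal.absNorm (q.1 : Ideal (𝓞 M)) : ℕ) : ZMod p) ≠ 0 →
      ∑ ω, X ω q.1 = (χ (ClassGroup.mk0 q.1) : ℂ) *
        if ((Ideal.absNorm (q.1 : Ideal (𝓞 M)) : ℕ) : ZMod p) ^ m = 1 then (p.totient : ℂ) else 0 := by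
    intro q hq
    rw [← DirichletCharacter.sum_characters_eq, Finset.mul_sum]
    refine Finset.sum_congr rfl fun ω _ => ?_
    simp only [X, MonoidHom.mul_apply]
    congr 1
    have h1 : (ω ^ m) ((Ideal.absNorm (q.1 : Ideal (𝓞 M)) : ℕ) : ZMod p) =
        ω (((Ideal.absNorm (q.1 : Ideal (𝓞 M)) : ℕ) : ZMod p) ^ m) := by
      rw [MulChar.pow_apply' _ hm0, map_pow]
    rw [← h1]
    split_ifs with h2
    · rw [h2, MulChar.one_apply (isUnit_iff_ne_zero.mpr hq), MonoidHom.one_apply]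
    · rfl
  refine hdiv (euler_main X hX ?_ ?_ _ ?_)
  · -- boundedness
    intro ω
    by_cases hω : ω ^ m = 1
    · refine dirichlet_bounded (X ω) (hX ω) ?_
      convert! wsum_bound_one χ hχ using 6 with B T hT
      refine congrArg (fun Y => wsum Y T) (funext fun I => ?_)
      simp only [X, if_pos hω]
      rfl
    · refine dirichlet_bounded (X ω) (hX ω) ?_
      have hodd : (ω ^ m) (-1) = 1 := by
        rw [MulChar.pow_apply' _ hm0, ← map_pow, hm2.neg_one_pow, map_one]
      have hne : (ω ^ m) ^ finrank ℚ M ≠ 1 := by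
        intro hcon
        apply hω
        have h1 : (ω ^ m) ^ (h ^ b) = 1 := by
          have hcard : Nat.card (ZMod p)ˣ = p - 1 := by
            rw [Nat.card_eq_fintype_card, ZMod.card_units_eq_totient, Nat.totient_prime hp]
          rw [← pow_mul, mul_comm, ← hbm, ← hcard, Nat.card_eq_fintype_card]
          exact MulChar.pow_card_eq_one ω
        have h2 : Nat.Coprime (finrank ℚ M) (h ^ b) := (hn.pow_left b).symm
        have := (pow_gcd_eq_one (a := ω ^ m) (m := finrank ℚ M) (n := h ^ b)).mpr ⟨hcon, h1⟩
        rwa [h2.gcd_eq_one, pow_one] at this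
      obtain ⟨u, hu⟩ := (MulChar.ne_one_iff).mp hne
      have hu' : (ω ^ m) (((u : ZMod p).val : ℤ) : ZMod p) ^ finrank ℚ M ≠ 1 := by
        rw [MulChar.pow_apply_coe] at hu
        simpa using hu
      have hcop : IsCoprime (((u : ZMod p).val : ℕ) : ℤ) (p : ℤ) := by
        rw [Nat.isCoprime_iff_coprime]
        exact (ZMod.isUnit_iff_coprime _ _).mp (by simp)
      convert! wsum_bound_char χ p hp (ω ^ m) hodd _ hcop hu' using 6 with B T hT
      refine congrArg (fun Y => wsum Y T) (funext fun I => ?_)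
      simp only [X, if_neg hω]
      rfl
  · -- nonnegativity
    intro q
    by_cases hq : ((Ideal.absNorm (q.1 : Ideal (𝓞 M)) : ℕ) : ZMod p) = 0
    · refine Finset.sum_nonneg fun ω _ => ?_
      have h1 : chiHom χ q.1 = 1 := by
        change ((χ (ClassGroup.mk0 q.1) : ℂˣ) : ℂ) = 1
        rw [hχ1 q (Or.inl hq), Units.val_one]
      simp only [X, MonoidHom.mul_apply, h1, one_mul]
      split_ifs
      · simp
      · have : psiHom (ω ^ m) q.1 = 0 := by
          change (ω ^ m) ((Ideal.absNorm (q.1 : Ideal (𝓞 M)) : ℕ) : ZMod p) = 0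
          rw [hq]
          exact MulChar.map_zero _
        rw [this]; simp
    · rw [← Complex.re_sum, hsumval q hq]
      split_ifs with h2
      · rw [hχ1 q (Or.inr h2)]; simp
      · simp
  · intro q hq
    rw [Set.mem_ofPred_eq] at hq
    have hq0 : ((Ideal.absNorm (q.1 : Ideal (𝓞 M)) : ℕ) : ZMod p) ≠ 0 := by
      intro h0
      rw [h0, zero_pow hm0] at hq
      exact zero_ne_one hq
    rw [← Complex.re_sum, hsumval q hq0, if_pos hq, hχ1 q (Or.inr hq), Units.val_one, one_mul,
      Complex.natCast_re]
    exact_mod_cast Nat.totient_pos.mpr hp.pos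

end contra

end S19

namespace S19

open Module NumberField nonZeroDivisors

section classHom

/-- A multiplicative map of ideals preserving principal ideals descends to class groups. -/
theorem exists_classHom {S R : Type*} [CommRing S] [IsDedekindDomain S]
    [CommRing R] [IsDedekindDomain R] (φ : Ideal S →* Ideal R)
    (h0 : ∀ I, φ I = ⊥ → I = ⊥) (h1 : ∀ x : S, ∃ y : R, φ (Ideal.span {x}) = Ideal.span {y}) :
    ∃ N : ClassGroup S →* ClassGroup R, ∀ (I : (Ideal S)⁰) (J : (Ideal R)⁰),
      φ (I : Ideal S) = (J : Ideal R) → N (ClassGroup.mk0 I) = ClassGroup.mk0 J := by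
  have hne : ∀ I : (Ideal S)⁰, φ (I : Ideal S) ∈ (Ideal R)⁰ := fun I =>
    mem_nonZeroDivisors_of_ne_zero fun h => nonZeroDivisors.coe_ne_zero I (h0 _ h)
  let F : (Ideal S)⁰ → ClassGroup R := fun I => ClassGroup.mk0 ⟨φ (I : Ideal S), hne I⟩
  have hF : ∀ I J, ClassGroup.mk0 I = ClassGroup.mk0 J → F I = F J := by
    intro I J hIJ
    obtain ⟨x, y, hx, hy, hxy⟩ := ClassGroup.mk0_eq_mk0_iff.mp hIJ
    obtain ⟨x', hx'⟩ := h1 x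
    obtain ⟨y', hy'⟩ := h1 y
    refine ClassGroup.mk0_eq_mk0_iff.mpr ⟨x', y', ?_, ?_, ?_⟩
    · rintro rfl
      rw [Ideal.span_singleton_zero] at hx'
      exact hx (Ideal.span_singleton_eq_bot.mp (h0 _ hx'))
    · rintro rfl
      rw [Ideal.span_singleton_zero] at hy'
      exact hy (Ideal.span_singleton_eq_bot.mp (h0 _ hy'))
    · change Ideal.span {x'} * φ (I : Ideal S) = Ideal.span {y'} * φ (J : Ideal S)
      rw [← hx', ← hy', ← map_mul, ← map_mul, hxy]
  let s := Function.surjInv (ClassGroup.mk0_surjective (R := S))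
  have hs : ∀ c, ClassGroup.mk0 (s c) = c := Function.surjInv_eq ClassGroup.mk0_surjective
  have hFm : ∀ I J, F (I * J) = F I * F J := by
    intro I J
    simp only [F]
    rw [← map_mul]
    congr 1
    ext1
    simp
  refine ⟨MonoidHom.mk' (fun c => F (s c)) fun a b => ?_, fun I J hIJ => ?_⟩
  · rw [← hFm]
    apply hF
    rw [map_mul, hs, hs, hs]
  · change F (s _) = _
    rw [hF (s (ClassGroup.mk0 I)) I (hs _)]
    exact congrArg ClassGroup.mk0 (Subtype.ext hIJ)

end classHom

section arith

variable {K M : Type*} [Field K] [NumberField K] [Field M] [NumberField M] [Algebra M K]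

theorem exists_classNorm : ∃ N : ClassGroup (𝓞 K) →* ClassGroup (𝓞 M),
    ∀ (I : (Ideal (𝓞 K))⁰) (J : (Ideal (𝓞 M))⁰),
      Ideal.relNorm (𝓞 M) (I : Ideal (𝓞 K)) = (J : Ideal (𝓞 M)) →
        N (ClassGroup.mk0 I) = ClassGroup.mk0 J :=
  exists_classHom ((Ideal.relNorm (𝓞 M) : Ideal (𝓞 K) →*₀ Ideal (𝓞 M)) : Ideal (𝓞 K) →* Ideal (𝓞 M))
    (fun I hI => Ideal.relNorm_eq_bot_iff.mp hI)
    (fun x => ⟨_, Ideal.relNorm_singleton (𝓞 M) x⟩)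

variable (M) in
theorem exists_classExt : ∃ N : ClassGroup (𝓞 M) →* ClassGroup (𝓞 K),
    ∀ (I : (Ideal (𝓞 M))⁰) (J : (Ideal (𝓞 K))⁰),
      Ideal.map (algebraMap (𝓞 M) (𝓞 K)) (I : Ideal (𝓞 M)) = (J : Ideal (𝓞 K)) →
        N (ClassGroup.mk0 I) = ClassGroup.mk0 J :=
  exists_classHom ((Ideal.mapHom (algebraMap (𝓞 M) (𝓞 K)) : Ideal (𝓞 M) →+* Ideal (𝓞 K)) :
      Ideal (𝓞 M) →* Ideal (𝓞 K))
    (fun I hI => (Ideal.map_eq_bot_iff_of_injective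
      (FaithfulSMul.algebraMap_injective (𝓞 M) (𝓞 K))).mp hI)
    (fun x => ⟨algebraMap _ _ x, by
      change Ideal.map _ _ = _
      rw [Ideal.map_span, Set.image_singleton]⟩)

theorem prime_data (p : ℕ) (hp : p.Prime) [IsCyclotomicExtension {p} ℚ K]
    (q : ℕ) (hq : q.Prime) (𝔮 : Ideal (𝓞 M)) [𝔮.IsMaximal] [𝔮.LiesOver (Ideal.span {(q : ℤ)})] :
    ∃ (f f' : ℕ) (𝔔 : (Ideal (𝓞 K))⁰), Ideal.relNorm (𝓞 M) (𝔔 : Ideal (𝓞 K)) = 𝔮 ^ f ∧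
      Ideal.absNorm 𝔮 = q ^ f' ∧ f' * f = if q = p then 1 else orderOf (q : ZMod p) := by
  obtain ⟨Q, hQ1, hQ2⟩ := Ideal.exists_maximal_ideal_liesOver_of_isIntegral (S := 𝓞 K) 𝔮
  have hQ3 : Q.LiesOver (Ideal.span {(q : ℤ)}) := Ideal.LiesOver.trans Q 𝔮 _
  have := Fact.mk hp
  have := Fact.mk hq
  have hQ0 : Q ≠ ⊥ := Ideal.IsMaximal.ne_bot_of_isIntegral_int Q
  refine ⟨Q.inertiaDeg (𝓞 M), 𝔮.inertiaDeg ℤ, ⟨Q, mem_nonZeroDivisors_of_ne_zero hQ0⟩,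
    Ideal.relNorm_eq_pow_of_isMaximal Q 𝔮, ?_, ?_⟩
  · exact (Ideal.pow_inertiaDeg q 𝔮).symm
  · rw [← Ideal.inertiaDeg_tower]
    split_ifs with h
    · subst h
      exact IsCyclotomicExtension.Rat.inertiaDeg_eq_of_prime q K Q
    · have : NeZero p := ⟨hp.ne_zero⟩
      exact IsCyclotomicExtension.Rat.inertiaDeg_eq_of_not_dvd q K Q
        (fun hd => h ((Nat.prime_dvd_prime_iff_eq hq hp).mp hd))

end arith

end S19

namespace S19

open Module NumberField nonZeroDivisors


open ArithmeticFunction vonMangoldt Filter Topology in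
theorem not_summable_primes (p : ℕ) [NeZero p] :
    ¬ Summable fun n : ℕ => if n.Prime ∧ (n : ZMod p) = 1 then (n : ℝ)⁻¹ else 0 := by
  intro hsum
  obtain ⟨C, hC⟩ := LSeries_residueClass_lower_bound (q := p) (a := 1) isUnit_one
  have hlim : Tendsto (fun x : ℝ => ∑' n : ℕ, (x - 1) * (residueClass (1 : ZMod p) n / (n : ℝ) ^ x))
      (𝓝[>] 1) (𝓝 (∑' n : ℕ, (0 : ℝ))) := by
    refine tendsto_tsum_of_dominated_convergence
      ((summable_residueClass_non_primes_div (1 : ZMod p)).add hsum) ?_ ?_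
    · intro n
      have : ContinuousAt
          (fun x : ℝ => (x - 1) * (residueClass (1 : ZMod p) n / (n : ℝ) ^ x)) 1 := by
        rcases n.eq_zero_or_pos with rfl | hn
        · simp only [residueClass_apply_zero, zero_div, mul_zero]
          exact continuousAt_const
        · have hn' : (0 : ℝ) < n := by exact_mod_cast hn
          have h1 : ContinuousAt (fun x : ℝ => (n : ℝ) ^ x) 1 :=
            Real.continuousAt_const_rpow hn'.ne'
          exact (continuousAt_id.sub continuousAt_const).mul
            (continuousAt_const.div h1 (Real.rpow_pos_of_pos hn' _).ne')
      have h2 := this.tendsto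
      simp only [sub_self, zero_mul] at h2
      exact h2.mono_left nhdsWithin_le_nhds
    · have hev : ∀ᶠ x : ℝ in 𝓝[>] 1, x ∈ Set.Ioc (1 : ℝ) 2 :=
        Ioc_mem_nhdsGT (by norm_num)
      filter_upwards [hev] with x hx n
      have hx1 : 0 < x - 1 := sub_pos.mpr hx.1
      rcases n.eq_zero_or_pos with rfl | hn
      · simp
      have hn' : (0 : ℝ) < n := by exact_mod_cast hn
      have hpow : (n : ℝ) ^ x = n ^ (x - 1) * n := by
        conv_lhs => rw [show x = (x - 1) + 1 by ring, Real.rpow_add hn', Real.rpow_one]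
      have hn1 : (1 : ℝ) ≤ (n : ℝ) ^ (x - 1) :=
        Real.one_le_rpow (by exact_mod_cast hn) hx1.le
      have hr := residueClass_nonneg (1 : ZMod p) n
      rw [Real.norm_of_nonneg (mul_nonneg hx1.le (div_nonneg hr (by positivity)))]
      by_cases hnp : n.Prime
      · simp only [hnp, true_and, if_true, zero_div, zero_add]
        by_cases hn2 : (n : ZMod p) = 1
        · have hres : residueClass (1 : ZMod p) n = Real.log n := by
            rw [residueClass, Set.indicator_of_mem (by exact hn2), vonMangoldt_apply_prime hnp]
          rw [if_pos hn2, hres, hpow]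
          have h3 := Real.log_le_rpow_div hn'.le hx1
          rw [le_div_iff₀ hx1] at h3
          rw [mul_div_assoc', div_le_iff₀ (by positivity)]
          have : (n : ℝ)⁻¹ * (n ^ (x - 1) * n) = n ^ (x - 1) := by field_simp
          rw [this]; linarith
        · have hres : residueClass (1 : ZMod p) n = 0 := by
            rw [residueClass, Set.indicator_of_notMem (by exact hn2)]
          rw [if_neg hn2, hres]
          simp
      · simp only [hnp, false_and, if_false, add_zero]
        rw [hpow, mul_div_assoc', div_le_div_iff₀ (by positivity) hn']
        have h4 : x - 1 ≤ 1 := by linarith [hx.2]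
        have h5 : (x - 1) * residueClass (1 : ZMod p) n ≤ residueClass (1 : ZMod p) n * n ^ (x - 1) := by
          nlinarith
        nlinarith
  rw [tsum_zero] at hlim
  have hlow : Tendsto (fun x : ℝ => (p.totient : ℝ)⁻¹ - C * (x - 1)) (𝓝[>] 1)
      (𝓝 ((p.totient : ℝ)⁻¹)) := by
    have : Continuous (fun x : ℝ => (p.totient : ℝ)⁻¹ - C * (x - 1)) := by fun_prop
    have h2 := this.tendsto 1
    simp only [sub_self, mul_zero, sub_zero] at h2
    exact h2.mono_left nhdsWithin_le_nhds
  have hle := le_of_tendsto_of_tendsto hlow hlim (by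
    have hev : ∀ᶠ x : ℝ in 𝓝[>] 1, x ∈ Set.Ioc (1 : ℝ) 2 :=
      Ioc_mem_nhdsGT (by norm_num)
    filter_upwards [hev] with x hx
    have hx1 : 0 < x - 1 := sub_pos.mpr hx.1
    rw [tsum_mul_left]
    have h3 := mul_le_mul_of_nonneg_left (hC hx) hx1.le
    have h4 : (x - 1) * ((p.totient : ℝ)⁻¹ / (x - 1) - C) = (p.totient : ℝ)⁻¹ - C * (x - 1) := by
      field_simp
    linarith)
  have hq : 0 < (p.totient : ℝ)⁻¹ := inv_pos.mpr (mod_cast p.totient.pos_of_neZero)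
  linarith


section arith2

variable {K M : Type*} [Field K] [NumberField K] [Field M] [NumberField M] [Algebra M K]

/-- The primes above rational primes congruent to one mod `p` already give divergence. -/
theorem primes_diverge (K : Type*) [Field K] [NumberField K] [Algebra M K]
    (p : ℕ) (hp : p.Prime) [IsCyclotomicExtension {p} ℚ K] (m : ℕ) :
    ¬ Summable fun q : {q : PP M | ((Ideal.absNorm (q.1 : Ideal (𝓞 M)) : ℕ) : ZMod p) ^ m = 1} =>
      (Ideal.absNorm (q.1.1 : Ideal (𝓞 M)) : ℝ)⁻¹ := by
  intro hsum
  have := Fact.mk hp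
  have : NeZero p := ⟨hp.ne_zero⟩
  have key : ∀ n : {n : ℕ | n.Prime ∧ (n : ZMod p) = 1}, ∃ q : PP M,
      Ideal.absNorm (q.1 : Ideal (𝓞 M)) = n := by
    rintro ⟨n, hn, hn1⟩
    have hnZ : Prime (n : ℤ) := Nat.prime_iff_prime_int.mp hn
    have hmax : (Ideal.span {(n : ℤ)}).IsMaximal :=
      ((Ideal.span_singleton_prime hnZ.ne_zero).mpr hnZ).isMaximal
        (by simpa using hn.ne_zero)
    obtain ⟨Q, hQ1, hQ2⟩ := Ideal.exists_maximal_ideal_liesOver_of_isIntegral (S := 𝓞 M)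
      (Ideal.span {(n : ℤ)})
    have hQ0 : Q ≠ ⊥ := Ideal.IsMaximal.ne_bot_of_isIntegral_int Q
    obtain ⟨f, f', 𝔔, h1, h2, h3⟩ := prime_data (K := K) p hp n hn Q
    refine ⟨⟨⟨Q, mem_nonZeroDivisors_of_ne_zero hQ0⟩, hQ1.isPrime⟩, ?_⟩
    have hnp : n ≠ p := by
      rintro rfl
      simp at hn1
    rw [if_neg hnp, hn1, orderOf_one] at h3
    have hf' : f' = 1 := Nat.eq_one_of_mul_eq_one_right h3
    change Ideal.absNorm Q = n
    rw [h2, hf', pow_one]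
  choose g hg using key
  have hmem : ∀ n, g n ∈ {q : PP M | ((Ideal.absNorm (q.1 : Ideal (𝓞 M)) : ℕ) : ZMod p) ^ m = 1} := by
    intro n
    rw [Set.mem_ofPred_eq, hg, n.2.2, one_pow]
  have hinj : Function.Injective (fun n => (⟨g n, hmem n⟩ :
      {q : PP M | ((Ideal.absNorm (q.1 : Ideal (𝓞 M)) : ℕ) : ZMod p) ^ m = 1})) := by
    intro a b hab
    have h1 : g a = g b := congrArg Subtype.val hab
    apply Subtype.ext
    rw [← hg a, ← hg b, h1]
  have h2 := hsum.comp_injective hinj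
  apply not_summable_primes p
  have h3 : Summable ((fun n : ℕ => (n : ℝ)⁻¹) ∘
      (Subtype.val : {n : ℕ | n.Prime ∧ (n : ZMod p) = 1} → ℕ)) := by
    refine h2.congr fun n => ?_
    simp only [Function.comp_apply, hg]
  rw [summable_subtype_iff_indicator] at h3
  refine h3.congr fun n => ?_
  rw [Set.indicator_apply]
  rfl

theorem norm_index (p : ℕ) (hp : p.Prime) (hp2 : p ≠ 2) [IsCyclotomicExtension {p} ℚ K]
    (h : ℕ) (hh : h.Prime) (hh2 : h ≠ 2) (hn : Nat.Coprime h (finrank ℚ M))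
    (N : ClassGroup (𝓞 K) →* ClassGroup (𝓞 M))
    (hN : ∀ (I : (Ideal (𝓞 K))⁰) (J : (Ideal (𝓞 M))⁰),
      Ideal.relNorm (𝓞 M) (I : Ideal (𝓞 K)) = (J : Ideal (𝓞 M)) →
        N (ClassGroup.mk0 I) = ClassGroup.mk0 J) : ¬ h ∣ N.range.index := by
  intro hdvd
  have := Fact.mk hh
  have := Fact.mk hp
  -- a character of order `h` on the quotient
  obtain ⟨χ, hχ, hχh, hχN⟩ : ∃ χ : ClassGroup (𝓞 M) →* ℂˣ, χ ≠ 1 ∧ χ ^ h = 1 ∧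
      ∀ x, χ (N x) = 1 := by
    let Q := ClassGroup (𝓞 M) ⧸ N.range
    have hcard : Nat.card (Q →* ℂˣ) = Nat.card Q :=
      CommGroup.card_monoidHom_of_hasEnoughRootsOfUnity Q ℂ
    have hd : h ∣ Nat.card (Q →* ℂˣ) := by
      rw [hcard]; exact hdvd
    have : Finite (Q →* ℂˣ) := Nat.finite_of_card_ne_zero (by rw [hcard]; exact Nat.card_pos.ne')
    obtain ⟨ψ, hψ⟩ := exists_prime_orderOf_dvd_card' h hd
    refine ⟨ψ.comp (QuotientGroup.mk' N.range), ?_, ?_, ?_⟩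
    · intro h1
      have : ψ = 1 := by
        refine MonoidHom.ext fun x => Units.ext ?_
        obtain ⟨y, rfl⟩ := QuotientGroup.mk'_surjective N.range x
        have := congrArg (fun f : ClassGroup (𝓞 M) →* ℂˣ => ((f y : ℂˣ) : ℂ)) h1
        exact this
      rw [this, orderOf_one] at hψ
      exact hh.one_lt.ne hψ
    · have h1 : ψ ^ h = 1 := hψ ▸ pow_orderOf_eq_one ψ
      ext x
      have := congrArg (fun f : Q →* ℂˣ => ((f (QuotientGroup.mk' N.range x) : ℂˣ) : ℂ)) h1
      simpa only [MonoidHom.pow_apply, MonoidHom.one_apply, MonoidHom.comp_apply] using this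
    · intro x
      have : (QuotientGroup.mk' N.range) (N x) = 1 :=
        (QuotientGroup.eq_one_iff _).mpr ⟨x, rfl⟩
      rw [MonoidHom.comp_apply, this, map_one]
  have hp1 : p - 1 ≠ 0 := by have := hp.two_le; omega
  obtain ⟨b, m, hm, hbm⟩ := Nat.exists_eq_pow_mul_and_not_dvd hp1 h hh.ne_one
  refine char_contra p hp hp2 h hh hh2 hn b m hbm χ hχ ?_ (primes_diverge K p hp m)
  intro q hq
  have hqp := q.2
  have hq0 : (q.1 : Ideal (𝓞 M)) ≠ ⊥ := nonZeroDivisors.coe_ne_zero q.1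
  have hmax : (q.1 : Ideal (𝓞 M)).IsMaximal := hqp.isMaximal hq0
  have : NeZero (q.1 : Ideal (𝓞 M)) := ⟨hq0⟩
  set r := Ideal.absNorm (Ideal.under ℤ (q.1 : Ideal (𝓞 M))) with hr
  have hrp : r.Prime := Nat.absNorm_under_prime _
  have hlies : (q.1 : Ideal (𝓞 M)).LiesOver (Ideal.span {(r : ℤ)}) := by
    rw [hr, Int.ideal_span_absNorm_eq_self]
    infer_instance
  obtain ⟨f, f', 𝔔, h1, h2, h3⟩ := prime_data (K := K) p hp r hrp (q.1 : Ideal (𝓞 M))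
  have hχf : χ (ClassGroup.mk0 q.1) ^ f = 1 := by
    have := hN 𝔔 (q.1 ^ f) (by rw [h1]; simp)
    rw [← map_pow, ← map_pow, ← this, hχN]
  have hχh' : χ (ClassGroup.mk0 q.1) ^ h = 1 := by
    rw [← MonoidHom.pow_apply, hχh, MonoidHom.one_apply]
  have hcop : Nat.Coprime h f := by
    rw [hh.coprime_iff_not_dvd]
    intro hf
    split_ifs at h3 with hrp'
    · have : f = 1 := Nat.eq_one_of_mul_eq_one_left h3
      rw [this] at hf
      exact hh.one_lt.ne' (Nat.dvd_one.mp hf)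
    · have hr0 : (r : ZMod p) ≠ 0 := by
        rw [Ne, ZMod.natCast_eq_zero_iff]
        intro hd
        exact hrp' ((Nat.prime_dvd_prime_iff_eq hp hrp).mp hd).symm
      rw [h2] at hq
      rcases hq with hq | hq
      · rw [Nat.cast_pow] at hq
        exact hr0 (eq_zero_of_pow_eq_zero hq)
      · rw [Nat.cast_pow, ← pow_mul] at hq
        have h4 := orderOf_dvd_of_pow_eq_one hq
        rw [← h3] at h4
        have hf'0 : 0 < f' := by
          rcases Nat.eq_zero_or_pos f' with h0 | h0
          · rw [h0, pow_zero, Ideal.absNorm_eq_one_iff] at h2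
            exact absurd h2 hqp.ne_top
          · exact h0
        exact hm (hf.trans (Nat.dvd_of_mul_dvd_mul_left hf'0 h4))
  have := (pow_gcd_eq_one (a := χ (ClassGroup.mk0 q.1)) (m := h) (n := f)).mpr ⟨hχh', hχf⟩
  rwa [hcop.gcd_eq_one, pow_one] at this

end arith2

end S19

namespace S19

open Module NumberField nonZeroDivisors

section galois

variable {F L : Type*} [Field F] [NumberField F] [Field L] [NumberField L] [Algebra F L]

theorem absNorm_map_equiv (e : 𝓞 L ≃+* 𝓞 L) (I : Ideal (𝓞 L)) :
    Ideal.absNorm (I.map e) = Ideal.absNorm I := by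
  rw [Ideal.absNorm_apply, Ideal.absNorm_apply, Submodule.cardQuot_apply, Submodule.cardQuot_apply]
  exact (Nat.card_congr (Ideal.quotientEquiv I (I.map e) e rfl).toEquiv).symm

/-- The product of the Galois conjugates is the extension of the relative norm. -/
theorem prod_conj [IsGalois F L] (I : Ideal (𝓞 L)) :
    ∏ σ : L ≃ₐ[F] L, I.map (RingOfIntegers.mapRingEquiv (σ : L ≃+* L)) =
      (Ideal.relNorm (𝓞 F) I).map (algebraMap (𝓞 F) (𝓞 L)) := by
  by_cases hI : I = ⊥
  · subst hI
    rw [Ideal.relNorm_bot, Ideal.map_bot]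
    exact Finset.prod_eq_zero (Finset.mem_univ (1 : L ≃ₐ[F] L)) Ideal.map_bot
  have hle : (Ideal.relNorm (𝓞 F) I).map (algebraMap (𝓞 F) (𝓞 L)) ≤
      ∏ σ : L ≃ₐ[F] L, I.map (RingOfIntegers.mapRingEquiv (σ : L ≃+* L)) := by
    rw [Ideal.map_relNorm, Ideal.span_le]
    rintro _ ⟨x, hx, rfl⟩
    have : (algebraMap (𝓞 F) (𝓞 L)) (Algebra.intNorm (𝓞 F) (𝓞 L) x) =
        ∏ σ : L ≃ₐ[F] L, RingOfIntegers.mapRingEquiv (σ : L ≃+* L) x := by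
      apply RingOfIntegers.coe_injective
      have h1 := Algebra.algebraMap_intNorm (A := 𝓞 F) (K := F) (L := L) (B := 𝓞 L) x
      have h2 := congrArg (algebraMap F L) h1
      rw [Algebra.norm_eq_prod_automorphisms] at h2
      rw [map_prod]
      exact h2
    simp only [Function.comp_apply, SetLike.mem_coe]
    rw [this]
    exact Ideal.prod_mem_prod fun σ _ => Ideal.mem_map_of_mem _ hx
  obtain ⟨A, hA⟩ := Ideal.dvd_iff_le.mpr hle
  have hcard : Ideal.absNorm (∏ σ : L ≃ₐ[F] L, I.map (RingOfIntegers.mapRingEquiv (σ : L ≃+* L))) =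
      Ideal.absNorm ((Ideal.relNorm (𝓞 F) I).map (algebraMap (𝓞 F) (𝓞 L))) := by
    rw [map_prod, Ideal.absNorm_algebraMap, Ideal.absNorm_relNorm,
      Finset.prod_congr rfl (fun σ _ => absNorm_map_equiv _ I), Finset.prod_const,
      Finset.card_univ, ← Nat.card_eq_fintype_card, IsGalois.card_aut_eq_finrank,
      IsFractionRing.finrank_eq (𝓞 F) F (𝓞 L) L]
  have hne : Ideal.absNorm (∏ σ : L ≃ₐ[F] L, I.map (RingOfIntegers.mapRingEquiv (σ : L ≃+* L))) ≠ 0 := by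
    rw [map_prod, Finset.prod_congr rfl (fun σ _ => absNorm_map_equiv _ I), Finset.prod_const]
    exact pow_ne_zero _ (by rwa [Ne, Ideal.absNorm_eq_zero_iff])
  have hA1 : A = ⊤ := by
    rw [hA, map_mul] at hcard
    rw [← Ideal.absNorm_eq_one_iff]
    exact (mul_eq_left₀ hne).mp hcard.symm
  rw [hA, hA1, Ideal.mul_top]

/-- The Galois action on the class group. -/
theorem exists_action : ∃ a : (L ≃ₐ[ℚ] L) → ClassGroup (𝓞 L) →* ClassGroup (𝓞 L),
    ∀ (σ : L ≃ₐ[ℚ] L) (I J : (Ideal (𝓞 L))⁰),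
      Ideal.map (RingOfIntegers.mapRingEquiv (σ : L ≃+* L)) (I : Ideal (𝓞 L)) = (J : Ideal (𝓞 L)) →
      a σ (ClassGroup.mk0 I) = ClassGroup.mk0 J := by
  have : ∀ σ : L ≃ₐ[ℚ] L, ∃ N : ClassGroup (𝓞 L) →* ClassGroup (𝓞 L),
    ∀ (I J : (Ideal (𝓞 L))⁰),
      Ideal.map (RingOfIntegers.mapRingEquiv (σ : L ≃+* L)) (I : Ideal (𝓞 L)) = (J : Ideal (𝓞 L)) →
      N (ClassGroup.mk0 I) = ClassGroup.mk0 J := by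
    intro σ
    set e := RingOfIntegers.mapRingEquiv (σ : L ≃+* L)
    refine exists_classHom ((Ideal.mapHom (e : 𝓞 L →+* 𝓞 L) : Ideal (𝓞 L) →+* Ideal (𝓞 L)) :
      Ideal (𝓞 L) →* Ideal (𝓞 L)) (fun I hI => ?_) (fun x => ⟨e x, ?_⟩)
    · exact (Ideal.map_eq_bot_iff_of_injective (f := (e : 𝓞 L →+* 𝓞 L)) e.injective).mp hI
    · change Ideal.map _ _ = _
      rw [Ideal.map_span, Set.image_singleton]
      rfl
  choose a ha using this
  exact ⟨a, ha⟩

end galois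

end S19

namespace S19

open Module NumberField nonZeroDivisors

section final

variable {L : Type*} [Field L] [NumberField L]

theorem fixed_eq_one [IsGalois ℚ L] (h : ℕ) (hh : h.Prime) (hcop : Nat.Coprime h (finrank ℚ L))
    (hmin : ∀ F : IntermediateField ℚ L, F ≠ ⊤ → ¬ h ∣ classNumber F)
    (a : (L ≃ₐ[ℚ] L) → ClassGroup (𝓞 L) →* ClassGroup (𝓞 L))
    (ha : ∀ (σ : L ≃ₐ[ℚ] L) (I J : (Ideal (𝓞 L))⁰),
      Ideal.map (RingOfIntegers.mapRingEquiv (σ : L ≃+* L)) (I : Ideal (𝓞 L)) = (J : Ideal (𝓞 L)) →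
      a σ (ClassGroup.mk0 I) = ClassGroup.mk0 J)
    (g : L ≃ₐ[ℚ] L) (hg : g ≠ 1) (c : ClassGroup (𝓞 L)) (hc : c ^ h = 1)
    (hpow : ∀ σ ∈ Subgroup.zpowers g, a σ c = c) : c = 1 := by
  let F : IntermediateField ℚ L := IntermediateField.fixedField (Subgroup.zpowers g)
  have hfix : F.fixingSubgroup = Subgroup.zpowers g := IntermediateField.fixingSubgroup_fixedField _
  have hF : F ≠ ⊤ := by
    intro hF
    rw [hF, IntermediateField.fixingSubgroup_top] at hfix
    exact hg (Subgroup.zpowers_eq_bot.mp hfix.symm)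
  have hFn := hmin F hF
  obtain ⟨N, hN⟩ := exists_classNorm (K := L) (M := F)
  obtain ⟨E, hE⟩ := exists_classExt (K := L) F
  have hNc : N c = 1 := by
    have h1 : N c ^ h = 1 := by rw [← map_pow, hc, map_one]
    have h2 : N c ^ Nat.card (ClassGroup (𝓞 F)) = 1 := pow_card_eq_one'
    have h3 : Nat.Coprime h (Nat.card (ClassGroup (𝓞 F))) := by
      rw [hh.coprime_iff_not_dvd, Nat.card_eq_fintype_card]
      exact hFn
    have := pow_gcd_eq_one.mpr ⟨h1, h2⟩
    rwa [h3.gcd_eq_one, pow_one] at this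
  obtain ⟨I, rfl⟩ := ClassGroup.mk0_surjective c
  have hI0 : (I : Ideal (𝓞 L)) ≠ ⊥ := nonZeroDivisors.coe_ne_zero I
  -- the norm ideal
  let J : (Ideal (𝓞 F))⁰ := ⟨Ideal.relNorm (𝓞 F) (I : Ideal (𝓞 L)),
    mem_nonZeroDivisors_of_ne_zero fun h0 => hI0 (Ideal.relNorm_eq_bot_iff.mp h0)⟩
  have hinj := FaithfulSMul.algebraMap_injective (𝓞 F) (𝓞 L)
  let J' : (Ideal (𝓞 L))⁰ := ⟨Ideal.map (algebraMap (𝓞 F) (𝓞 L)) (J : Ideal (𝓞 F)),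
    mem_nonZeroDivisors_of_ne_zero fun h0 =>
      nonZeroDivisors.coe_ne_zero J ((Ideal.map_eq_bot_iff_of_injective hinj).mp h0)⟩
  have h1 : ClassGroup.mk0 J' = 1 := by
    rw [← hE J J' rfl, ← hN I J rfl, hNc, map_one]
  let Iσ : (L ≃ₐ[F] L) → (Ideal (𝓞 L))⁰ := fun σ =>
    ⟨Ideal.map (RingOfIntegers.mapRingEquiv (σ : L ≃+* L)) (I : Ideal (𝓞 L)),
      mem_nonZeroDivisors_of_ne_zero fun h0 => hI0 (by
        rw [← Ideal.absNorm_eq_zero_iff, ← absNorm_map_equiv, Ideal.absNorm_eq_zero_iff]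
        exact h0)⟩
  have h2 : ∏ σ, Iσ σ = J' := by
    apply Subtype.ext
    rw [Submonoid.coe_finsetProd]
    exact prod_conj (I : Ideal (𝓞 L))
  have h3 : ∀ σ, ClassGroup.mk0 (Iσ σ) = ClassGroup.mk0 I := by
    intro σ
    have hmem : σ.restrictScalars ℚ ∈ Subgroup.zpowers g := by
      rw [← hfix]
      rintro x
      exact σ.commutes x
    rw [← ha (σ.restrictScalars ℚ) I (Iσ σ) rfl]
    exact hpow _ hmem
  have h4 : ClassGroup.mk0 I ^ Nat.card (L ≃ₐ[F] L) = 1 := by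
    rw [← h1, ← h2, map_prod, Finset.prod_congr rfl (fun σ _ => h3 σ), Finset.prod_const,
      Finset.card_univ, Nat.card_eq_fintype_card]
  have h5 : Nat.card (L ≃ₐ[F] L) ∣ finrank ℚ L := by
    rw [IsGalois.card_aut_eq_finrank]
    exact ⟨finrank ℚ F, by rw [mul_comm, finrank_mul_finrank]⟩
  have h6 := hcop.coprime_dvd_right h5
  have := pow_gcd_eq_one.mpr ⟨hc, h4⟩
  rwa [h6.gcd_eq_one, pow_one] at this

theorem dvd_of_free [IsGalois ℚ L] (h : ℕ) (hh : h.Prime) (hcop : Nat.Coprime h (finrank ℚ L))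
    (hmin : ∀ F : IntermediateField ℚ L, F ≠ ⊤ → ¬ h ∣ classNumber F)
    (hT : Nat.card {c : ClassGroup (𝓞 L) // c ^ h = 1} = h) : finrank ℚ L ∣ h - 1 := by
  obtain ⟨a, ha⟩ := exists_action (L := L)
  have hne : ∀ (σ : L ≃ₐ[ℚ] L) (I : (Ideal (𝓞 L))⁰),
      Ideal.map (RingOfIntegers.mapRingEquiv (σ : L ≃+* L)) (I : Ideal (𝓞 L)) ∈ (Ideal (𝓞 L))⁰ :=
    fun σ I => mem_nonZeroDivisors_of_ne_zero fun h0 => nonZeroDivisors.coe_ne_zero I (by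
        change (I : Ideal (𝓞 L)) = ⊥
        rw [← Ideal.absNorm_eq_zero_iff, ← absNorm_map_equiv, Ideal.absNorm_eq_zero_iff]
        exact h0)
  have ha1 : ∀ c, a 1 c = c := by
    intro c
    obtain ⟨I, rfl⟩ := ClassGroup.mk0_surjective c
    refine ha 1 I I ?_
    exact Ideal.map_id _
  have hamul : ∀ σ τ c, a (σ * τ) c = a σ (a τ c) := by
    intro σ τ c
    obtain ⟨I, rfl⟩ := ClassGroup.mk0_surjective c
    rw [ha τ I ⟨_, hne τ I⟩ rfl, ha σ _ ⟨_, hne σ ⟨_, hne τ I⟩⟩ rfl]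
    refine ha _ I _ ?_
    exact (Ideal.map_map (RingOfIntegers.mapRingEquiv (τ : L ≃+* L) : 𝓞 L →+* 𝓞 L)
      (RingOfIntegers.mapRingEquiv (σ : L ≃+* L) : 𝓞 L →+* 𝓞 L)).symm
  let X := {c : ClassGroup (𝓞 L) // c ^ h = 1 ∧ c ≠ 1}
  let _ : MulAction (L ≃ₐ[ℚ] L) X :=
    { smul := fun σ c => ⟨a σ c.1, by rw [← map_pow, c.2.1, map_one], fun h1 => c.2.2 (by
        rw [← ha1 c.1, ← inv_mul_cancel σ, hamul, h1, map_one])⟩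
      one_smul := fun c => Subtype.ext (ha1 c.1)
      mul_smul := fun σ τ c => Subtype.ext (hamul σ τ c.1) }
  have hfree : ∀ c : X, MulAction.stabilizer (L ≃ₐ[ℚ] L) c = ⊥ := by
    intro c
    rw [eq_bot_iff]
    intro g hg
    rw [Subgroup.mem_bot]
    by_contra hg1
    refine c.2.2 (fixed_eq_one h hh hcop hmin a ha g hg1 c.1 c.2.1 fun σ hσ => ?_)
    have : σ ∈ MulAction.stabilizer (L ≃ₐ[ℚ] L) c := (Subgroup.zpowers_le.mpr hg) hσ
    exact congrArg Subtype.val (MulAction.mem_stabilizer_iff.mp this)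
  have hcard := Nat.card_congr (MulAction.selfEquivOrbitsQuotientProd hfree)
  rw [Nat.card_prod, IsGalois.card_aut_eq_finrank] at hcard
  have hX : Nat.card X = h - 1 := by
    have e : {c : {c : ClassGroup (𝓞 L) // c ^ h = 1} // c ≠ ⟨1, one_pow h⟩} ≃ X :=
      { toFun := fun c => ⟨c.1.1, c.1.2, fun h1 => c.2 (Subtype.ext h1)⟩
        invFun := fun c => ⟨⟨c.1, c.2.1⟩, fun h1 => c.2.2 (congrArg Subtype.val h1)⟩
        left_inv := fun c => rfl
        right_inv := fun c => rfl }
    classical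
    have h1 : Nat.card {c : {c : ClassGroup (𝓞 L) // c ^ h = 1} // c ≠ ⟨1, one_pow h⟩} =
        Nat.card {c : ClassGroup (𝓞 L) // c ^ h = 1} - 1 := by
      rw [Nat.card_eq_fintype_card, Nat.card_eq_fintype_card,
        Fintype.card_subtype_compl, Fintype.card_subtype_eq]
    rw [← Nat.card_congr e, h1, hT]
  rw [hX] at hcard
  exact ⟨_, by rw [hcard, mul_comm]⟩

end final

end S19

namespace S19

open Module NumberField nonZeroDivisors

theorem card_torsion {A B : Type*} [CommGroup A] [Finite A] [CommGroup B] [Finite B]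
    (N : A →* B) (h : ℕ) (hh : h.Prime) (hidx : ¬ h ∣ N.range.index) (hB : h ∣ Nat.card B)
    (P : Sylow h A) (hP : IsCyclic (P : Subgroup A)) : Nat.card {c : B // c ^ h = 1} = h := by
  have := Fact.mk hh
  have hA0 : Nat.card A ≠ 0 := Nat.card_pos.ne'
  obtain ⟨k, m, hm, hkm⟩ := Nat.exists_eq_pow_mul_and_not_dvd hA0 h hh.ne_one
  have hsub : ∀ b : B, b ^ h = 1 → b ∈ (P : Subgroup A).map N := by
    intro b hb
    have hbu : ∀ u : ℕ, Nat.Coprime h u → ∃ v : ℕ, b = b ^ (u * v) := by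
      intro u hu
      obtain ⟨v, hv⟩ := Nat.exists_mul_mod_eq_one_of_coprime hu.symm hh.one_lt
      refine ⟨v, ?_⟩
      rw [pow_eq_pow_mod (u * v) hb, hv.2, pow_one]
    obtain ⟨v, hv⟩ := hbu N.range.index (hh.coprime_iff_not_dvd.mpr hidx)
    have hbr : b ∈ N.range := by
      rw [hv, pow_mul]
      exact Subgroup.pow_mem _ (Subgroup.pow_index_mem _ _) _
    obtain ⟨x, rfl⟩ := hbr
    obtain ⟨w, hw⟩ := hbu m (hh.coprime_iff_not_dvd.mpr hm)
    refine ⟨x ^ (m * w), ?_, by rw [map_pow]; exact hw.symm⟩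
    have hpg : IsPGroup h (Subgroup.zpowers (x ^ (m * w))) := by
      rw [IsPGroup.iff_card]
      have : orderOf (x ^ (m * w)) ∣ h ^ k := by
        apply orderOf_dvd_of_pow_eq_one
        rw [← pow_mul, show m * w * h ^ k = (h ^ k * m) * w by ring, ← hkm, pow_mul,
          pow_card_eq_one', one_pow]
      obtain ⟨j, _, hj⟩ := (Nat.dvd_prime_pow hh).mp this
      exact ⟨j, by rw [Nat.card_zpowers, hj]⟩
    obtain ⟨Q, hQ⟩ := hpg.exists_le_sylow
    have hu := Sylow.unique_of_normal P inferInstance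
    have : Q = P := Subsingleton.elim _ _
    rw [this] at hQ
    exact hQ (Subgroup.mem_zpowers _)
  have hC : IsCyclic ((P : Subgroup A).map N) :=
    isCyclic_of_surjective (N.subgroupMap (P : Subgroup A)) (N.subgroupMap_surjective _)
  classical
  have := Fintype.ofFinite ((P : Subgroup A).map N)
  have := Fintype.ofFinite {c : B // c ^ h = 1}
  apply le_antisymm
  · refine le_trans ?_ (IsCyclic.card_pow_eq_one_le (α := (P : Subgroup A).map N) hh.pos)
    rw [Nat.card_eq_fintype_card, ← Finset.card_univ]
    refine Finset.card_le_card_of_injOn (fun c => ⟨c.1, hsub c.1 c.2⟩) ?_ ?_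
    · intro c _
      simp only [Finset.coe_filter, Finset.mem_univ, true_and, Set.mem_ofPred_eq]
      exact Subtype.ext c.2
    · intro c _ d _ hcd
      exact Subtype.ext (congrArg (fun z => z.1) hcd)
  · obtain ⟨y, hy⟩ := exists_prime_orderOf_dvd_card' h hB
    have hcy : Nat.card (Subgroup.zpowers y) = h := by rw [Nat.card_zpowers, hy]
    refine hcy.symm.le.trans ?_
    refine Nat.card_le_card_of_injective
      (fun z : Subgroup.zpowers y => (⟨z.1, ?_⟩ : {c : B // c ^ h = 1})) ?_
    · obtain ⟨j, hj⟩ := z.2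
      rw [← hj, ← hy]
      change (y ^ j) ^ orderOf y = 1
      rw [← zpow_natCast, ← zpow_mul, mul_comm, zpow_mul, zpow_natCast, pow_orderOf_eq_one,
        one_zpow]
    · intro z w hzw
      exact Subtype.ext (Subtype.mk.inj hzw)

end S19

theorem statement19
    (p : ℕ) (hp : p.Prime) (hp2 : p ≠ 2)
    (K : Type*) [Field K] [NumberField K]
    [IsCyclotomicExtension {p} ℚ K]
    (h : ℕ) (hh : h.Prime) (hhodd : h ≠ 2)
    (hdvd : h ∣ NumberField.classNumber K)
    (P : Sylow h (ClassGroup (𝓞 K)))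
    (hcyc : IsCyclic (↥(P : Subgroup (ClassGroup (𝓞 K)))))
    (M : IntermediateField ℚ K)
    (hM : h ∣ NumberField.classNumber M)
    (hMmin : ∀ M' : IntermediateField ℚ K, h ∣ NumberField.classNumber M' →
      Module.finrank ℚ M ≤ Module.finrank ℚ M')
    (hcop : Nat.Coprime h (Module.finrank ℚ M)) :
    Module.finrank ℚ M ∣ h - 1 := by
  obtain ⟨N, hN⟩ := S19.exists_classNorm (K := K) (M := M)
  have hidx := S19.norm_index p hp hp2 h hh hhodd hcop N hN
  have : IsAbelianGalois ℚ K := IsCyclotomicExtension.isAbelianGalois {p} ℚ K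
  have hB : h ∣ Nat.card (ClassGroup (𝓞 M)) := by
    rw [Nat.card_eq_fintype_card]; exact hM
  have hab : @IsAbelianGalois ℚ M _ _ M.algebra' := inferInstance
  have hgal : @IsGalois ℚ _ M _ M.algebra' := hab.toIsGalois
  have hgal' : IsGalois ℚ M := by
    convert! hgal
  refine S19.dvd_of_free h hh hcop ?_ (S19.card_torsion N h hh hidx hB P hcyc)
  intro F hF hFd
  have h1 : h ∣ NumberField.classNumber (IntermediateField.lift F) := by
    have e := ClassGroup.mulEquiv (NumberField.RingOfIntegers.mapRingEquiv
      (IntermediateField.liftAlgEquiv F : F ≃+* IntermediateField.lift F))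
    have := Nat.card_congr e.toEquiv
    rw [Nat.card_eq_fintype_card, Nat.card_eq_fintype_card] at this
    rw [NumberField.classNumber, ← this]
    exact hFd
  have h2 := hMmin _ h1
  rw [← (IntermediateField.liftAlgEquiv F).toLinearEquiv.finrank_eq] at h2
  apply hF
  refine IntermediateField.eq_of_le_of_finrank_le le_top ?_
  rwa [IntermediateField.finrank_top']
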